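/- arXiv:1707.01402 — 6 statements merged into one kernel-verified Lean document; each statement's English description precedes it below -/
import Mathlib

section
/- Let ν, ρ̂ ∈ (0,1], α > 0, δ > 0, M ≥ 0, and let R : ℂ → ℂ be holomorphic on the strip S_ρ̂ with |R(x)| ≤ M·e^{−ν|x|} for all x ∈ S_ρ̂. Set K₁ := −(1/(2δ))·∫₀^{+∞} e^{−(iα+δ)s}·R(s) ds, and for x = ξ + iη ∈ S_ρ̂ define I₁(x) := (e^{(iα+δ)x}/(2δ))·( i·e^{−(iα+δ)ξ}·∫₀^η e^{(α−iδ)η'}·R(ξ + iη') dη' − ∫_ξ^{+∞} e^{−(iα+δ)ξ'}·R(ξ') dξ' ). Then for all x = ξ + iη ∈ S_ρ̂ one has |I₁(x)| ≤ 2·M·e^{(α+ν)ρ̂}·(ν·δ)^{−1}·e^{−ν·ξ}. -/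
/-- The vertical part of the integral, for a function bounded by `C` on the vertical segment. -/
theorem norm_vertical_integral_le {α δ ρ C η : ℝ} (hα : 0 < α) (hC : 0 ≤ C) (hη : |η| < ρ)
    (f : ℝ → ℂ) (hf : ∀ t : ℝ, |t| < ρ → ‖f t‖ ≤ C) :
    ‖∫ t in (0:ℝ)..η, Complex.exp (((α:ℂ) - Complex.I * δ) * t) * f t‖ ≤
      Real.exp (α * (η + ρ)) * C * ρ := by
  have hη' := abs_lt.1 hη
  refine (intervalIntegral.norm_integral_le_of_norm_le_const
    (C := Real.exp (α * (η + ρ)) * C) fun t ht => ?_).trans ?_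
  · have htη : |t| < ρ ∧ t ≤ η + ρ := by
      rw [abs_lt]
      rcases Set.mem_uIoc.1 ht with h | h <;>
        exact ⟨⟨by linarith, by linarith⟩, by linarith⟩
    rw [norm_mul, Complex.norm_exp]
    have hre : (((α:ℂ) - Complex.I * δ) * t).re = α * t := by simp
    rw [hre]
    have := hf t htη.1
    have := htη.2
    gcongr
  · rw [sub_zero]
    gcongr

/-- The horizontal part of the integral, for a function with exponential decay. -/
theorem norm_horizontal_integral_le {α δ ν M ξ : ℝ} (hδν : 0 < δ + ν)
    (f : ℝ → ℂ) (hf : ∀ t : ℝ, ξ < t → ‖f t‖ ≤ M * Real.exp (-ν * t)) :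
    ‖∫ t in Set.Ioi ξ, Complex.exp (-(Complex.I * α + δ) * t) * f t‖ ≤
      M * (Real.exp (-(δ + ν) * ξ) / (δ + ν)) := by
  have hneg : -(δ + ν) < 0 := by linarith
  have hint := (integrableOn_exp_mul_Ioi hneg ξ).const_mul M
  refine (MeasureTheory.norm_integral_le_of_norm_le hint ?_).trans_eq ?_
  · refine (MeasureTheory.ae_restrict_iff' measurableSet_Ioi).2 (.of_forall fun t ht => ?_)
    rw [norm_mul, Complex.norm_exp]
    have hre : (-(Complex.I * α + δ) * (t:ℂ)).re = -δ * t := by simp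
    rw [hre]
    calc Real.exp (-δ * t) * ‖f t‖ ≤ Real.exp (-δ * t) * (M * Real.exp (-ν * t)) := by
          gcongr
          exact hf t ht
      _ = M * Real.exp (-(δ + ν) * t) := by
          rw [mul_left_comm, ← Real.exp_add]
          ring_nf
  · rw [MeasureTheory.integral_const_mul, integral_exp_mul_Ioi hneg, neg_div_neg_eq]

/-- Bound on the first piece `I₁` of the decaying particular solution of
`B'' − 2iα·B' − β²·B = R` (case `β > α`, `δ = √(β² − α²)`) on the semi-infinite strip
`S_ρ̂ = {x : Re x > −ρ̂, |Im x| < ρ̂}`: for `x = ξ + iη ∈ S_ρ̂`,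
`|I₁(x)| ≤ 2·M·e^{(α+ν)ρ̂}·(νδ)⁻¹·e^{−νξ}`. -/
theorem bound_I_one
    (ν ρ : ℝ) (hν : ν ∈ Set.Ioc (0:ℝ) 1) (hρ : ρ ∈ Set.Ioc (0:ℝ) 1)
    (α δ M : ℝ) (hα : 0 < α) (hδ : 0 < δ) (hM : 0 ≤ M)
    (S : Set ℂ) (hS : S = {x : ℂ | -ρ < x.re ∧ |x.im| < ρ})
    (R : ℂ → ℂ) (hR : DifferentiableOn ℂ R S)
    (hRbound : ∀ x ∈ S, ‖R x‖ ≤ M * Real.exp (-ν * ‖x‖))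
    (K₁ : ℂ)
    (hK₁ : K₁ = -(1 / (2 * (δ:ℂ))) *
      ∫ s in Set.Ioi (0:ℝ), Complex.exp (-(Complex.I * α + δ) * s) * R s)
    (I₁ : ℂ → ℂ)
    (hI₁ : ∀ x : ℂ, I₁ x =
      (Complex.exp ((Complex.I * α + δ) * x) / (2 * (δ:ℂ))) *
        (Complex.I * Complex.exp (-(Complex.I * α + δ) * (x.re : ℂ)) *
            (∫ η' in (0:ℝ)..x.im,
              Complex.exp (((α:ℂ) - Complex.I * δ) * η') * R ((x.re : ℂ) + Complex.I * η'))
          - ∫ ξ' in Set.Ioi x.re,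
              Complex.exp (-(Complex.I * α + δ) * ξ') * R ξ')) :
    ∀ x ∈ S, ‖I₁ x‖ ≤ 2 * M * Real.exp ((α + ν) * ρ) * (ν * δ)⁻¹ * Real.exp (-ν * x.re) := by
  obtain ⟨hν0, hν1⟩ := hν
  obtain ⟨hρ0, hρ1⟩ := hρ
  subst hS
  rintro x ⟨hξ, hη⟩
  have hη' := abs_lt.1 hη
  have hRre : ∀ z : ℂ, -ρ < z.re → |z.im| < ρ → ‖R z‖ ≤ M * Real.exp (-ν * z.re) := by
    intro z h1 h2
    refine (hRbound z ⟨h1, h2⟩).trans ?_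
    have := Complex.re_le_norm z
    gcongr M * Real.exp ?_
    nlinarith
  have hV := norm_vertical_integral_le (δ := δ) hα
    (by positivity : 0 ≤ M * Real.exp (-ν * x.re)) hη
    (fun t => R ((x.re : ℂ) + Complex.I * t)) (fun t ht => by
      simpa using hRre ((x.re : ℂ) + Complex.I * t) (by simpa using hξ) (by simpa using ht))
  have hH := norm_horizontal_integral_le (α := α) (δ := δ) (ν := ν) (M := M) (ξ := x.re)
    (by linarith) (fun t => R t) (fun t ht => by
      simpa using hRre (t : ℂ) (by simpa using hξ.trans ht) (by simpa using hρ0))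
  have hpre : ‖Complex.exp ((Complex.I * α + δ) * x) / (2 * (δ:ℂ))‖ =
      Real.exp (δ * x.re - α * x.im) / (2 * δ) := by
    rw [norm_div, Complex.norm_exp]
    congr 1
    · congr 1
      simp [sub_eq_add_neg, add_comm]
    · simp [abs_of_pos hδ]
  have hmid : ‖Complex.I * Complex.exp (-(Complex.I * α + δ) * (x.re : ℂ))‖ =
      Real.exp (-δ * x.re) := by
    rw [norm_mul, Complex.norm_exp]
    simp
  rw [hI₁, norm_mul, hpre]
  have hinv : ρ ≤ ν⁻¹ := hρ1.trans ((one_le_inv₀ hν0).2 hν1)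
  have hinv' : (δ + ν)⁻¹ ≤ ν⁻¹ := inv_anti₀ hν0 (by linarith)
  calc _ ≤ Real.exp (δ * x.re - α * x.im) / (2 * δ) *
        (Real.exp (-δ * x.re) * (Real.exp (α * (x.im + ρ)) * (M * Real.exp (-ν * x.re)) * ρ) +
          M * (Real.exp (-(δ + ν) * x.re) / (δ + ν))) := by
        gcongr
        refine (norm_sub_le _ _).trans (add_le_add ?_ hH)
        rw [norm_mul, hmid]
        gcongr
    _ = M / (2 * δ) * (Real.exp (α * ρ - ν * x.re) * ρ +
          Real.exp (-α * x.im - ν * x.re) * (δ + ν)⁻¹) := by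
        have e1 : Real.exp (α * ρ - ν * x.re) = Real.exp (δ * x.re - α * x.im) *
            Real.exp (-δ * x.re) * Real.exp (α * (x.im + ρ)) * Real.exp (-ν * x.re) := by
          simp only [← Real.exp_add]
          ring_nf
        have e2 : Real.exp (-α * x.im - ν * x.re) = Real.exp (δ * x.re - α * x.im) *
            Real.exp (-(δ + ν) * x.re) := by
          simp only [← Real.exp_add]
          ring_nf
        rw [e1, e2]
        ring
    _ ≤ M / (2 * δ) * (Real.exp ((α + ν) * ρ - ν * x.re) * ν⁻¹ +
          Real.exp ((α + ν) * ρ - ν * x.re) * ν⁻¹) := by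
        have : 0 ≤ ν * ρ := by positivity
        have h1 : α * ρ - ν * x.re ≤ (α + ν) * ρ - ν * x.re := by linarith
        have h2 : -α * x.im - ν * x.re ≤ (α + ν) * ρ - ν * x.re := by nlinarith
        gcongr
    _ = M * Real.exp ((α + ν) * ρ) * (ν * δ)⁻¹ * Real.exp (-ν * x.re) := by
        rw [sub_eq_add_neg, Real.exp_add, ← neg_mul, mul_inv]
        field_simp
        ring
    _ ≤ _ := by
        gcongr
        linarith
end

section
/- Let ν, ρ̂ ∈ (0,1], α > 0, β > α, M ≥ 0, set δ := √(β² − α²) > 0, and let R : ℂ → ℂ be holomorphic on the strip S_ρ̂ with |R(x)| ≤ M·e^{−ν|x|} for all x ∈ S_ρ̂. Then there exists a holomorphic function B : S_ρ̂ → ℂ such that B''(x) − 2iα·B'(x) − β²·B(x) = R(x) for all x ∈ S_ρ̂, and moreover |B(x)| ≤ 8·M·e^{(α+2ν)ρ̂}·(ν·δ)^{−1}·e^{−ν·Re(x)/2} and |B'(x)| ≤ 8·M·(2+α)·e^{(α+2ν)ρ̂}·max(1, δ^{−1})·ν^{−1}·e^{−ν·Re(x)/2} for all x ∈ S_ρ̂.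 -/
open Filter Topology Set

/-- The semi-infinite complex strip `{x : Re x > -ρ, |Im x| < ρ}`. -/
def semiStrip (ρ : ℝ) : Set ℂ := {x | -ρ < x.re ∧ |x.im| < ρ}

theorem semiStrip_eq_reProdIm (ρ : ℝ) : semiStrip ρ = Ioi (-ρ) ×ℂ Ioo (-ρ) ρ := by
  ext x
  simp [semiStrip, Complex.mem_reProdIm, abs_lt]

theorem convex_semiStrip (ρ : ℝ) : Convex ℝ (semiStrip ρ) := by
  rw [semiStrip_eq_reProdIm]
  exact ((convex_Ioi _).linear_preimage Complex.reLm).inter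
    ((convex_Ioo _ _).linear_preimage Complex.imLm)

theorem isOpen_semiStrip (ρ : ℝ) : IsOpen (semiStrip ρ) := by
  rw [semiStrip_eq_reProdIm]
  exact isOpen_Ioi.reProdIm isOpen_Ioo

theorem add_ofReal_mem_semiStrip {ρ : ℝ} {x : ℂ} (hx : x ∈ semiStrip ρ) {s : ℝ} (hs : 0 ≤ s) :
    x + s ∈ semiStrip ρ := by
  simp only [semiStrip, mem_ofPred_eq, Complex.add_re, Complex.ofReal_re, Complex.add_im,
    Complex.ofReal_im, add_zero] at hx ⊢
  exact ⟨by linarith, hx.2⟩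

theorem neg_add_smul_mem_semiStrip {ρ : ℝ} {x : ℂ} (hx : x ∈ semiStrip ρ) {s : ℝ}
    (hs : s ∈ Ioc (0 : ℝ) 1) : -(ρ : ℂ) + s * (x + ρ) ∈ semiStrip ρ := by
  obtain ⟨h1, h2⟩ := hx
  obtain ⟨h3, h4⟩ := hs
  simp only [semiStrip, mem_ofPred_eq, Complex.add_re, Complex.add_im, Complex.neg_re,
    Complex.neg_im, Complex.ofReal_re, Complex.ofReal_im, Complex.re_ofReal_mul,
    Complex.im_ofReal_mul]
  refine ⟨by nlinarith, ?_⟩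
  rw [neg_zero, zero_add, add_zero, abs_mul, abs_of_pos h3]
  nlinarith [abs_nonneg x.im]

theorem exists_primitive_exp_mul_on_semiStrip {ρ : ℝ} {R : ℂ → ℂ}
    (hR : DifferentiableOn ℂ R (semiStrip ρ)) (l : ℂ) :
    ∃ P : ℂ → ℂ, ∀ x ∈ semiStrip ρ, HasDerivAt P (Complex.exp (-(l * x)) * R x) x := by
  have hf : DifferentiableOn ℂ (fun x => Complex.exp (-(l * x)) * R x) (semiStrip ρ) := by
    fun_prop
  obtain ⟨P, hP⟩ := (convex_semiStrip ρ).exists_forall_hasDerivWithinAt hf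
  exact ⟨P, fun x hx => (hP x hx).hasDerivAt ((isOpen_semiStrip ρ).mem_nhds hx)⟩

/-- Variation of constants. -/
theorem HasDerivAt.exp_mul_sub_const {P : ℂ → ℂ} {l c r x : ℂ}
    (hP : HasDerivAt P (Complex.exp (-(l * x)) * r) x) :
    HasDerivAt (fun z => Complex.exp (l * z) * (P z - c))
      (l * (Complex.exp (l * x) * (P x - c)) + r) x := by
  have h := (((hasDerivAt_id x).const_mul l).cexp).mul (hP.sub_const c)
  convert! h using 1
  have : Complex.exp (l * x) * Complex.exp (-(l * x)) = 1 := by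
    rw [← Complex.exp_add]; simp
  simp only [id, mul_one]
  linear_combination -r * this

theorem norm_sub_le_of_norm_deriv_le_exp {u u' : ℝ → ℂ} {a b K k : ℝ} (hab : a ≤ b) (hk : 0 < k)
    (hK : 0 ≤ K) (hu : ∀ s ∈ Icc a b, HasDerivAt u (u' s) s)
    (bound : ∀ s ∈ Icc a b, ‖u' s‖ ≤ K * Real.exp (-(k * s))) :
    ‖u b - u a‖ ≤ K / k * Real.exp (-(k * a)) := by
  have hB : ∀ s : ℝ, HasDerivAt
      (fun s => K / k * Real.exp (-(k * a)) - K / k * Real.exp (-(k * s)))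
      (K * Real.exp (-(k * s))) s := by
    intro s
    have h := ((((hasDerivAt_id s).const_mul k).neg.exp).const_mul (K / k)).const_sub
      (K / k * Real.exp (-(k * a)))
    convert! h using 1
    simp only [id, Pi.neg_apply]
    field_simp
  have h := image_norm_le_of_norm_deriv_right_le_deriv_boundary (f := fun s => u s - u a)
    (f' := u') (a := a) (b := b)
    (fun s hs => ((hu s hs).sub_const (u a)).continuousAt.continuousWithinAt)
    (fun s hs => ((hu s (Ico_subset_Icc_self hs)).sub_const (u a)).hasDerivWithinAt)
    (by simp) hB (fun s hs => bound s (Ico_subset_Icc_self hs)) (right_mem_Icc.2 hab)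
  have : 0 ≤ K / k * Real.exp (-(k * b)) := by positivity
  linarith

theorem norm_exp_neg_mul_add_ofReal (l x : ℂ) (s : ℝ) :
    ‖Complex.exp (-(l * (x + s)))‖ = ‖Complex.exp (-(l * x))‖ * Real.exp (-(l.re * s)) := by
  simp only [Complex.norm_exp, ← Real.exp_add]
  congr 1
  simp
  ring

/-- Integration along the horizontal ray from `x` to infinity solves `G' = l G + R` with decay. -/
theorem exists_solution_from_infinity {ν ρ M : ℝ} (hν : 0 < ν) (hρ : 0 < ρ) (hρ1 : ρ ≤ 1)
    (hM : 0 ≤ M) {R : ℂ → ℂ}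
    (hR : DifferentiableOn ℂ R (semiStrip ρ))
    (hRb : ∀ x ∈ semiStrip ρ, ‖R x‖ ≤ M * Real.exp (-ν * ‖x‖)) (l : ℂ) (hk : 0 < ν + l.re) :
    ∃ G : ℂ → ℂ, ∀ x ∈ semiStrip ρ, HasDerivAt G (l * G x + R x) x ∧
      ‖G x‖ ≤ M / (ν + l.re) * Real.exp (-(ν * x.re)) := by
  obtain ⟨P, hP⟩ := exists_primitive_exp_mul_on_semiStrip hR l
  set k := ν + l.re with hkdef
  have hRre : ∀ x ∈ semiStrip ρ, ‖R x‖ ≤ M * Real.exp (-(ν * x.re)) := fun x hx => by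
    refine (hRb x hx).trans ?_
    gcongr
    nlinarith [Complex.re_le_norm x]
  have hray : ∀ x ∈ semiStrip ρ, ∀ a b : ℝ, 0 ≤ a → a ≤ b → ‖P (x + b) - P (x + a)‖ ≤
      ‖Complex.exp (-(l * x))‖ * M * Real.exp (-(ν * x.re)) / k * Real.exp (-(k * a)) := by
    intro x hx a b ha hab
    refine norm_sub_le_of_norm_deriv_le_exp (u := fun s : ℝ => P (x + s))
      (u' := fun s : ℝ => Complex.exp (-(l * (x + s))) * R (x + s)) hab hk (by positivity) ?_ ?_
    · intro s hs
      have h1 := hP _ (add_ofReal_mem_semiStrip hx (ha.trans hs.1))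
      have h2 : HasDerivAt (fun z : ℂ => P (x + z)) _ (s : ℂ) := h1.comp_const_add x (s : ℂ)
      exact h2.comp_ofReal
    · intro s hs
      rw [norm_mul, norm_exp_neg_mul_add_ofReal]
      have h1 := hRre _ (add_ofReal_mem_semiStrip hx (ha.trans hs.1))
      simp only [Complex.add_re, Complex.ofReal_re] at h1
      calc _ ≤ ‖Complex.exp (-(l * x))‖ * Real.exp (-(l.re * s)) *
            (M * Real.exp (-(ν * (x.re + s)))) := by gcongr
        _ = ‖Complex.exp (-(l * x))‖ * M * (Real.exp (-(l.re * s)) *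
            Real.exp (-(ν * (x.re + s)))) := by ring
        _ = ‖Complex.exp (-(l * x))‖ * M * (Real.exp (-(ν * x.re)) * Real.exp (-(k * s))) := by
          rw [← Real.exp_add, ← Real.exp_add, hkdef]; congr 2; ring
        _ = _ := by ring
  have hexp : Tendsto (fun n : ℕ => Real.exp (-(k * n))) atTop (𝓝 0) :=
    Real.tendsto_exp_neg_atTop_nhds_zero.comp
      (tendsto_natCast_atTop_atTop.const_mul_atTop hk)
  have hlim : ∀ x ∈ semiStrip ρ, ∃ L, Tendsto (fun n : ℕ => P (x + (n : ℝ))) atTop (𝓝 L) := by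
    intro x hx
    refine cauchySeq_tendsto_of_complete (cauchySeq_of_le_tendsto_0'
      (fun n : ℕ => ‖Complex.exp (-(l * x))‖ * M * Real.exp (-(ν * x.re)) / k *
        Real.exp (-(k * n))) ?_ ?_)
    · intro n m hnm
      rw [dist_comm, dist_eq_norm]
      exact hray x hx n m (by positivity) (by exact_mod_cast hnm)
    · simpa using hexp.const_mul (‖Complex.exp (-(l * x))‖ * M * Real.exp (-(ν * x.re)) / k)
  have h0 : (0 : ℂ) ∈ semiStrip ρ := by simp [semiStrip, hρ]
  obtain ⟨L, hL⟩ := hlim 0 h0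
  have hbd : ∀ z ∈ semiStrip ρ, ‖Complex.exp (-(l * z)) * R z‖ ≤
      M * Real.exp (|l.im| * ρ) * Real.exp (-(k * z.re)) := by
    intro z hz
    rw [norm_mul, Complex.norm_exp]
    have h2 : l.im * z.im ≤ |l.im| * ρ := by
      refine (le_abs_self _).trans ?_
      rw [abs_mul]
      exact mul_le_mul_of_nonneg_left hz.2.le (abs_nonneg _)
    calc _ ≤ Real.exp (-(l.re * z.re) + |l.im| * ρ) * (M * Real.exp (-(ν * z.re))) := by
          gcongr
          · simp only [Complex.neg_re, Complex.mul_re]; linarith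
          · exact hRre z hz
      _ = M * (Real.exp (-(l.re * z.re) + |l.im| * ρ) * Real.exp (-(ν * z.re))) := by ring
      _ = M * (Real.exp (|l.im| * ρ) * Real.exp (-(k * z.re))) := by
          rw [← Real.exp_add, ← Real.exp_add, hkdef]; congr 2; ring
      _ = _ := by ring
  have hLx : ∀ x ∈ semiStrip ρ, Tendsto (fun n : ℕ => P (x + (n : ℝ))) atTop (𝓝 L) := by
    intro x hx
    have hdiff : Tendsto (fun n : ℕ => P (x + (n : ℝ)) - P (0 + (n : ℝ))) atTop (𝓝 0) := by
      refine squeeze_zero_norm (a := fun n : ℕ =>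
        M * Real.exp (|l.im| * ρ) * Real.exp k * ‖x‖ * Real.exp (-(k * n))) ?_ ?_
      · intro n
        have hconv : Convex ℝ (semiStrip ρ ∩ {z : ℂ | (n : ℝ) - 1 ≤ z.re}) :=
          (convex_semiStrip ρ).inter (convex_halfSpace_re_ge _)
        have hb := hconv.norm_image_sub_le_of_norm_hasDerivWithin_le (f := P)
          (f' := fun z => Complex.exp (-(l * z)) * R z)
          (C := M * Real.exp (|l.im| * ρ) * Real.exp (-(k * (n - 1))))
          (x := 0 + ((n : ℝ) : ℂ)) (y := x + ((n : ℝ) : ℂ))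
          (fun z hz => (hP z hz.1).hasDerivWithinAt)
          (fun z hz => (hbd z hz.1).trans (by have := hz.2; simp only [mem_ofPred_eq] at this; gcongr))
          ⟨add_ofReal_mem_semiStrip h0 (by positivity), by simp⟩
          ⟨add_ofReal_mem_semiStrip hx (by positivity), by
            have := hx.1
            simp; linarith⟩
        refine hb.trans (le_of_eq ?_)
        have : Real.exp (-(k * (n - 1))) = Real.exp k * Real.exp (-(k * n)) := by
          rw [← Real.exp_add]; congr 1; ring
        rw [this, zero_add, add_sub_cancel_right]
        ring
      · simpa using hexp.const_mul (M * Real.exp (|l.im| * ρ) * Real.exp k * ‖x‖)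
    simpa using hdiff.add hL
  refine ⟨fun z => Complex.exp (l * z) * (P z - L), fun x hx =>
    ⟨(hP x hx).exp_mul_sub_const, ?_⟩⟩
  have hPL : ‖L - P x‖ ≤ ‖Complex.exp (-(l * x))‖ * M * Real.exp (-(ν * x.re)) / k := by
    refine le_of_tendsto ((hLx x hx).sub_const (P x)).norm (Eventually.of_forall fun n => ?_)
    simpa using hray x hx 0 n le_rfl (by positivity)
  have h1 : ‖Complex.exp (l * x)‖ * ‖Complex.exp (-(l * x))‖ = 1 := by
    rw [← norm_mul, ← Complex.exp_add]; simp
  rw [norm_mul, norm_sub_rev]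
  calc _ ≤ ‖Complex.exp (l * x)‖ *
        (‖Complex.exp (-(l * x))‖ * M * Real.exp (-(ν * x.re)) / k) := by gcongr
    _ = (‖Complex.exp (l * x)‖ * ‖Complex.exp (-(l * x))‖) *
        (M / k * Real.exp (-(ν * x.re))) := by ring
    _ = _ := by rw [h1, one_mul]

/-- Integration from the left end `-ρ` of the strip solves `G' = l G + R` with decay, if `l` is
sufficiently stable. -/
theorem exists_solution_from_corner {ν ρ M : ℝ} (hν : 0 < ν) (hρ : 0 < ρ)
    (hM : 0 ≤ M) {R : ℂ → ℂ}
    (hR : DifferentiableOn ℂ R (semiStrip ρ))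
    (hRb : ∀ x ∈ semiStrip ρ, ‖R x‖ ≤ M * Real.exp (-ν * ‖x‖)) (l : ℂ) (hl : l.re ≤ -(ν / 2)) :
    ∃ G : ℂ → ℂ, ∀ x ∈ semiStrip ρ, HasDerivAt G (l * G x + R x) x ∧
      ‖G x‖ ≤ 2 * M / ν * Real.exp ((|l.im| + 2 * ν) * ρ) * Real.exp (-(ν * x.re) / 2) := by
  obtain ⟨P, hP⟩ := exists_primitive_exp_mul_on_semiStrip hR l
  -- `P` extends continuously to the boundary point `-ρ`
  obtain ⟨L, hL⟩ : ∃ L, Tendsto P (𝓝[semiStrip ρ] (-(ρ : ℂ))) (𝓝 L) := by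
    have hconv : Convex ℝ (semiStrip ρ ∩ Metric.ball (-(ρ : ℂ)) 1) :=
      (convex_semiStrip ρ).inter (convex_ball _ _)
    have hlip := hconv.lipschitzOnWith_of_nnnorm_hasDerivWithin_le (f := P)
      (f' := fun z => Complex.exp (-(l * z)) * R z)
      (C := (Real.exp (‖l‖ * (ρ + 1)) * M).toNNReal)
      (fun z hz => (hP z hz.1).hasDerivWithinAt) (by
        intro z hz
        rw [← NNReal.coe_le_coe, coe_nnnorm, norm_mul, Real.coe_toNNReal _ (by positivity)]
        have h1 : ‖z‖ ≤ ρ + 1 := by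
          have := norm_sub_le (z - (-(ρ : ℂ))) (ρ : ℂ)
          have h2 : ‖z - (-(ρ : ℂ))‖ < 1 := by simpa [dist_eq_norm] using hz.2
          have h3 : ‖(ρ : ℂ)‖ = ρ := by simp [hρ.le]
          rw [sub_neg_eq_add, add_sub_cancel_right] at this
          rw [sub_neg_eq_add] at h2
          linarith
        have h4 : ‖Complex.exp (-(l * z))‖ ≤ Real.exp (‖l‖ * (ρ + 1)) := by
          rw [Complex.norm_exp]
          gcongr
          refine (Complex.re_le_norm _).trans ?_
          rw [norm_neg, norm_mul]
          gcongr
        have h5 : ‖R z‖ ≤ M := by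
          refine (hRb z hz.1).trans (mul_le_of_le_one_right hM ?_)
          rw [Real.exp_le_one_iff]
          nlinarith [norm_nonneg z]
        exact mul_le_mul h4 h5 (norm_nonneg _) (by positivity))
    obtain ⟨g, hg, hgP⟩ := hlip.extend_finite_dimension
    refine ⟨g (-(ρ : ℂ)), (hg.continuous.continuousAt.tendsto.mono_left
      nhdsWithin_le_nhds).congr' ?_⟩
    filter_upwards [self_mem_nhdsWithin,
      mem_nhdsWithin_of_mem_nhds (Metric.ball_mem_nhds (-(ρ : ℂ)) one_pos)] with z h1 h2
    exact (hgP ⟨h1, h2⟩).symm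
  refine ⟨fun z => Complex.exp (l * z) * (P z - L), fun x hx =>
    ⟨(hP x hx).exp_mul_sub_const, ?_⟩⟩
  set y : ℂ := x + ρ with hy
  have hyre : 0 < y.re := by simpa [hy] using (by linarith [hx.1] : 0 < x.re + ρ)
  have hyn : 0 < ‖y‖ := hyre.trans_le (Complex.re_le_norm y)
  have hyle : ‖y‖ ≤ y.re + ρ := by
    refine (Complex.norm_le_abs_re_add_abs_im y).trans ?_
    rw [abs_of_pos hyre]
    have : |y.im| = |x.im| := by simp [hy]
    linarith [hx.2]
  set K := ‖y‖ * M * Real.exp (|l.im| * ρ + 3 * ν * ρ / 2 - ν * ‖y‖ / 2) with hK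
  have hseg : ∀ ε ∈ Ioc (0 : ℝ) 1,
      ‖Complex.exp (l * x) * (P x - P (-(ρ : ℂ) + ε * y))‖ ≤ K / (ν * ‖y‖ / 2) := by
    intro ε hε
    have h := norm_sub_le_of_norm_deriv_le_exp (a := ε) (b := 1) (k := ν * ‖y‖ / 2) (K := K)
      (u := fun s : ℝ => Complex.exp (l * x) * P (-(ρ : ℂ) + s * y))
      (u' := fun s : ℝ => Complex.exp (l * x) * (Complex.exp (-(l * (-(ρ : ℂ) + s * y))) *
        R (-(ρ : ℂ) + s * y) * y)) hε.2 (by positivity) (by positivity) ?_ ?_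
    · rw [← mul_sub] at h
      have h1 : -(ρ : ℂ) + ((1 : ℝ) : ℂ) * y = x := by simp [hy]
      rw [h1] at h
      refine h.trans (mul_le_of_le_one_right (by positivity) ?_)
      rw [Real.exp_le_one_iff]
      have := hε.1
      have : 0 ≤ ν * ‖y‖ / 2 * ε := by positivity
      linarith
    · intro s hs
      have h1 := hP _ (neg_add_smul_mem_semiStrip hx ⟨hε.1.trans_le hs.1, hs.2⟩)
      have h2 : HasDerivAt (fun z : ℂ => -(ρ : ℂ) + z * y) y (s : ℂ) := by
        simpa using ((hasDerivAt_id (s : ℂ)).mul_const y).const_add (-(ρ : ℂ))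
      exact (((h1.comp (s : ℂ) h2).const_mul (Complex.exp (l * x)))).comp_ofReal
    · intro s hs
      have hs0 : 0 < s := hε.1.trans_le hs.1
      set t : ℂ := -(ρ : ℂ) + s * y with ht
      have htS : t ∈ semiStrip ρ := neg_add_smul_mem_semiStrip hx ⟨hs0, hs.2⟩
      have htn : s * ‖y‖ - ρ ≤ ‖t‖ := by
        have h1 := norm_sub_norm_le ((s : ℂ) * y) (ρ : ℂ)
        have h2 : (s : ℂ) * y - ρ = t := by rw [ht]; ring
        rw [h2, norm_mul, Complex.norm_of_nonneg hs0.le, Complex.norm_of_nonneg hρ.le] at h1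
        exact h1
      have he : ‖Complex.exp (l * x) * Complex.exp (-(l * t))‖ ≤
          Real.exp (|l.im| * ρ - ν / 2 * (1 - s) * (‖y‖ - ρ)) := by
        rw [← Complex.exp_add, Complex.norm_exp]
        have h1 : l * x + -(l * t) = l * (((1 - s : ℝ) : ℂ) * y) := by
          rw [ht, hy]; push_cast; ring
        rw [h1, Complex.mul_re, Complex.re_ofReal_mul, Complex.im_ofReal_mul]
        have hs1 : 0 ≤ 1 - s := by linarith [hs.2]
        have h2 : -(l.im * ((1 - s) * y.im)) ≤ |l.im| * ρ := by
          have h3 : |y.im| ≤ ρ := by simpa [hy] using hx.2.le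
          refine (neg_le_abs _).trans ?_
          rw [abs_mul, abs_mul, abs_of_nonneg hs1]
          gcongr
          nlinarith [abs_nonneg y.im]
        have h4 : l.re * ((1 - s) * y.re) ≤ -(ν / 2) * ((1 - s) * (‖y‖ - ρ)) := by
          calc _ ≤ -(ν / 2) * ((1 - s) * y.re) := by gcongr
            _ ≤ _ := by
              have : (1 - s) * (‖y‖ - ρ) ≤ (1 - s) * y.re := by gcongr; linarith
              nlinarith
        refine Real.exp_le_exp.2 ?_
        linarith
      have hRt : ‖R t‖ ≤ M * Real.exp (-(ν * (s * ‖y‖ - ρ))) := by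
        refine (hRb t htS).trans ?_
        gcongr
        nlinarith
      calc _ = ‖y‖ * (‖Complex.exp (l * x) * Complex.exp (-(l * t))‖ * ‖R t‖) := by
            simp only [norm_mul]; ring
        _ ≤ ‖y‖ * (Real.exp (|l.im| * ρ - ν / 2 * (1 - s) * (‖y‖ - ρ)) *
            (M * Real.exp (-(ν * (s * ‖y‖ - ρ))))) := by gcongr
        _ = ‖y‖ * M * Real.exp (|l.im| * ρ - ν / 2 * (1 - s) * (‖y‖ - ρ) +
            -(ν * (s * ‖y‖ - ρ))) := by rw [Real.exp_add]; ring
        _ ≤ ‖y‖ * M * Real.exp (|l.im| * ρ + 3 * ν * ρ / 2 - ν * ‖y‖ / 2 +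
            -(ν * ‖y‖ / 2 * s)) := by
          refine mul_le_mul_of_nonneg_left (Real.exp_le_exp.2 ?_) (by positivity)
          have : 0 ≤ ν * ρ * s := by positivity
          nlinarith
        _ = _ := by rw [Real.exp_add, hK]; ring
  have hto : Tendsto (fun ε : ℝ => -(ρ : ℂ) + ε * y) (𝓝[>] 0) (𝓝[semiStrip ρ] (-(ρ : ℂ))) := by
    refine tendsto_nhdsWithin_iff.2 ⟨?_, ?_⟩
    · have : Continuous fun ε : ℝ => -(ρ : ℂ) + ε * y := by fun_prop
      simpa using (this.tendsto 0).mono_left nhdsWithin_le_nhds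
    · filter_upwards [Ioc_mem_nhdsGT (zero_lt_one' ℝ)] with ε hε
      exact neg_add_smul_mem_semiStrip hx hε
  have hle : ‖Complex.exp (l * x) * (P x - L)‖ ≤ K / (ν * ‖y‖ / 2) := by
    refine le_of_tendsto (((hL.comp hto).const_sub (P x)).const_mul _).norm ?_
    filter_upwards [Ioc_mem_nhdsGT (zero_lt_one' ℝ)] with ε hε using hseg ε hε
  refine hle.trans ?_
  have hKeq : K / (ν * ‖y‖ / 2) =
      2 * M / ν * Real.exp (|l.im| * ρ + 3 * ν * ρ / 2 - ν * ‖y‖ / 2) := by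
    rw [hK]; field_simp
  rw [hKeq, mul_assoc (2 * M / ν), ← Real.exp_add]
  refine mul_le_mul_of_nonneg_left (Real.exp_le_exp.2 ?_) (by positivity)
  have h1 : y.re = x.re + ρ := by simp [hy]
  have h2 := Complex.re_le_norm y
  have : 0 < ν * ρ := by positivity
  nlinarith


/-- Solvability with decay of `B'' − 2iα·B' − β²·B = R` on the semi-infinite strip
`S_ρ̂ = {x : Re x > −ρ̂, |Im x| < ρ̂}`, non-resonant oscillatory case `β > α`,
`δ = √(β² − α²)`: there is a holomorphic solution `B` with
`|B(x)| ≤ 8M e^{(α+2ν)ρ̂} (νδ)⁻¹ e^{−ν Re(x)/2}` and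
`|B'(x)| ≤ 8M(2+α) e^{(α+2ν)ρ̂} max(1, δ⁻¹) ν⁻¹ e^{−ν Re(x)/2}`. -/
theorem ode_solvability_case_beta_gt_alpha
    (ν ρ : ℝ) (hν : ν ∈ Set.Ioc (0:ℝ) 1) (hρ : ρ ∈ Set.Ioc (0:ℝ) 1)
    (α β M : ℝ) (hα : 0 < α) (hβ : α < β) (hM : 0 ≤ M)
    (δ : ℝ) (hδ : δ = Real.sqrt (β ^ 2 - α ^ 2))
    (S : Set ℂ) (hS : S = {x : ℂ | -ρ < x.re ∧ |x.im| < ρ})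
    (R : ℂ → ℂ) (hR : DifferentiableOn ℂ R S)
    (hRbound : ∀ x ∈ S, ‖R x‖ ≤ M * Real.exp (-ν * ‖x‖)) :
    ∃ B : ℂ → ℂ, DifferentiableOn ℂ B S ∧
      (∀ x ∈ S,
        deriv (deriv B) x - 2 * Complex.I * α * deriv B x - (β : ℂ) ^ 2 * B x = R x) ∧
      (∀ x ∈ S, ‖B x‖ ≤
        8 * M * Real.exp ((α + 2 * ν) * ρ) * (ν * δ)⁻¹ * Real.exp (-ν * x.re / 2)) ∧
      (∀ x ∈ S, ‖deriv B x‖ ≤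
        8 * M * (2 + α) * Real.exp ((α + 2 * ν) * ρ) * max 1 δ⁻¹ * ν⁻¹ *
          Real.exp (-ν * x.re / 2)) := by
  obtain ⟨hν0, -⟩ := hν
  obtain ⟨hρ0, hρ1⟩ := hρ
  obtain rfl : S = semiStrip ρ := hS
  have hpos : 0 < β ^ 2 - α ^ 2 := by nlinarith
  have hδ0 : 0 < δ := hδ ▸ Real.sqrt_pos.2 hpos
  have hδsq : (δ : ℂ) ^ 2 = (β : ℂ) ^ 2 - (α : ℂ) ^ 2 := by
    have : δ ^ 2 = β ^ 2 - α ^ 2 := by rw [hδ, Real.sq_sqrt hpos.le]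
    exact_mod_cast this
  set E : ℂ → ℝ := fun x => 2 * M / ν * Real.exp ((α + 2 * ν) * ρ) * Real.exp (-(ν * x.re) / 2)
    with hE
  have weaken : ∀ r : ℝ, -(ν / 2) ≤ r → ∀ x ∈ semiStrip ρ,
      M / (ν + r) * Real.exp (-(ν * x.re)) ≤ E x := by
    intro r hr x hx
    have h1 : M / (ν + r) ≤ 2 * M / ν := by
      calc M / (ν + r) ≤ M / (ν / 2) := by gcongr; linarith
        _ = _ := by field_simp
    rw [hE]
    simp only
    rw [mul_assoc (2 * M / ν), ← Real.exp_add]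
    gcongr
    have := hx.1
    have : 0 < α * ρ := by positivity
    nlinarith
  set l₁ : ℂ := Complex.I * α + δ with hl₁
  set l₂ : ℂ := Complex.I * α - δ with hl₂
  have hl₁re : l₁.re = δ := by simp [hl₁]
  have hl₂re : l₂.re = -δ := by simp [hl₂]
  have hl₂im : |l₂.im| = α := by simp [hl₂, abs_of_pos hα]
  obtain ⟨G₁, hG₁⟩ : ∃ G : ℂ → ℂ, ∀ x ∈ semiStrip ρ, HasDerivAt G (l₁ * G x + R x) x ∧
      ‖G x‖ ≤ E x := by
    obtain ⟨G, hG⟩ := exists_solution_from_infinity hν0 hρ0 hρ1 hM hR hRbound l₁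
      (by rw [hl₁re]; linarith)
    exact ⟨G, fun x hx => ⟨(hG x hx).1, (hG x hx).2.trans
      (weaken _ (by rw [hl₁re]; linarith) x hx)⟩⟩
  obtain ⟨G₂, hG₂⟩ : ∃ G : ℂ → ℂ, ∀ x ∈ semiStrip ρ, HasDerivAt G (l₂ * G x + R x) x ∧
      ‖G x‖ ≤ E x := by
    rcases le_total δ (ν / 2) with h | h
    · obtain ⟨G, hG⟩ := exists_solution_from_infinity hν0 hρ0 hρ1 hM hR hRbound l₂
        (by rw [hl₂re]; linarith)
      exact ⟨G, fun x hx => ⟨(hG x hx).1, (hG x hx).2.trans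
        (weaken _ (by rw [hl₂re]; linarith) x hx)⟩⟩
    · obtain ⟨G, hG⟩ := exists_solution_from_corner hν0 hρ0 hM hR hRbound l₂
        (by rw [hl₂re]; linarith)
      rw [hl₂im] at hG
      exact ⟨G, hG⟩
  have hδc : (δ : ℂ) ≠ 0 := by exact_mod_cast hδ0.ne'
  have hB : ∀ x ∈ semiStrip ρ, HasDerivAt (fun z => (G₁ z - G₂ z) / (2 * δ))
      ((l₁ * G₁ x - l₂ * G₂ x) / (2 * δ)) x := by
    intro x hx
    convert! ((hG₁ x hx).1.sub (hG₂ x hx).1).div_const (2 * (δ : ℂ)) using 1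
    ring
  have hE0 : ∀ x, 0 ≤ E x := fun x => by positivity
  refine ⟨fun z => (G₁ z - G₂ z) / (2 * δ),
    fun x hx => (hB x hx).differentiableAt.differentiableWithinAt, ?_, ?_, ?_⟩
  · intro x hx
    have hev : deriv (fun z => (G₁ z - G₂ z) / (2 * δ)) =ᶠ[𝓝 x]
        fun z => (l₁ * G₁ z - l₂ * G₂ z) / (2 * δ) := by
      filter_upwards [(isOpen_semiStrip ρ).mem_nhds hx] with z hz using (hB z hz).deriv
    have hB' := (((hG₁ x hx).1.const_mul l₁).sub ((hG₂ x hx).1.const_mul l₂)).div_const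
      (2 * (δ : ℂ))
    have hB'' : deriv (fun z => (l₁ * G₁ z - l₂ * G₂ z) / (2 * (δ : ℂ))) x = _ := hB'.deriv
    rw [hev.deriv_eq, (hB x hx).deriv, hB'']
    have e₁ : l₁ ^ 2 - 2 * Complex.I * α * l₁ - (β : ℂ) ^ 2 = 0 := by
      rw [hl₁]; linear_combination hδsq - (α : ℂ) ^ 2 * Complex.I_sq
    have e₂ : l₂ ^ 2 - 2 * Complex.I * α * l₂ - (β : ℂ) ^ 2 = 0 := by
      rw [hl₂]; linear_combination hδsq - (α : ℂ) ^ 2 * Complex.I_sq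
    have e₃ : l₁ - l₂ = 2 * δ := by rw [hl₁, hl₂]; ring
    field_simp
    linear_combination G₁ x * e₁ - G₂ x * e₂ + R x * e₃
  · intro x hx
    rw [norm_div]
    have h2 : ‖2 * (δ : ℂ)‖ = 2 * δ := by simp [abs_of_pos hδ0]
    rw [h2]
    calc _ ≤ (E x + E x) / (2 * δ) := by
          gcongr
          exact (norm_sub_le _ _).trans (add_le_add (hG₁ x hx).2 (hG₂ x hx).2)
      _ = 2 * (M * Real.exp ((α + 2 * ν) * ρ) * (ν * δ)⁻¹ * Real.exp (-ν * x.re / 2)) := by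
          rw [hE, neg_mul]; field_simp; ring
      _ ≤ 8 * (M * Real.exp ((α + 2 * ν) * ρ) * (ν * δ)⁻¹ * Real.exp (-ν * x.re / 2)) := by
          gcongr; norm_num
      _ = _ := by ring
  · intro x hx
    rw [(hB x hx).deriv, norm_div]
    have h2 : ‖2 * (δ : ℂ)‖ = 2 * δ := by simp [abs_of_pos hδ0]
    have hIα : ‖Complex.I * (α : ℂ)‖ = α := by simp [abs_of_pos hα]
    have hδn : ‖(δ : ℂ)‖ = δ := by simp [abs_of_pos hδ0]
    have n₁ : ‖l₁‖ ≤ α + δ := (norm_add_le _ _).trans_eq (by rw [hIα, hδn])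
    have n₂ : ‖l₂‖ ≤ α + δ := (norm_sub_le _ _).trans_eq (by rw [hIα, hδn])
    have hmax : (α + δ) * δ⁻¹ ≤ (2 + α) * max 1 δ⁻¹ := by
      have h3 : (α + δ) * δ⁻¹ = α * δ⁻¹ + 1 := by field_simp
      have h4 : α * δ⁻¹ ≤ α * max 1 δ⁻¹ := by gcongr; exact le_max_right _ _
      have h5 : 1 ≤ max 1 δ⁻¹ := le_max_left _ _
      linarith
    rw [h2]
    calc _ ≤ ((α + δ) * E x + (α + δ) * E x) / (2 * δ) := by
          gcongr
          refine (norm_sub_le _ _).trans ?_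
          rw [norm_mul, norm_mul]
          have := (hG₁ x hx).2
          have := (hG₂ x hx).2
          gcongr
      _ = 2 * ((α + δ) * δ⁻¹) *
          (M * Real.exp ((α + 2 * ν) * ρ) * ν⁻¹ * Real.exp (-ν * x.re / 2)) := by
          rw [hE, neg_mul]; field_simp; ring
      _ ≤ 8 * ((2 + α) * max 1 δ⁻¹) *
          (M * Real.exp ((α + 2 * ν) * ρ) * ν⁻¹ * Real.exp (-ν * x.re / 2)) := by
          gcongr; norm_num
      _ = _ := by ring
end

section
/- Let ν, ρ̂ ∈ (0,1], α > 0, 0 < β < α, M ≥ 0, set γ := √(α² − β²) > 0, and let R : ℂ → ℂ be holomorphic on the strip S_ρ̂ with |R(x)| ≤ M·e^{−ν|x|} for all x ∈ S_ρ̂. Then there exists a holomorphic function B : S_ρ̂ → ℂ such that B''(x) − 2iα·B'(x) − β²·B(x) = R(x) for all x ∈ S_ρ̂, and moreover |B(x)| ≤ 8·M·e^{(α+2ν)ρ̂ + γ}·(ν·γ)^{−1}·e^{−ν·Re(x)/2} and |B'(x)| ≤ 16·M·(2+α)·e^{(α+2ν)ρ̂ + γ}·max(1, γ^{−1})·ν^{−1}·e^{−ν·Re(x)/2}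 for all x ∈ S_ρ̂. -/
open MeasureTheory Set Filter Topology

/-- The solution of `u' - l u = R` that decays along the positive real direction. -/
noncomputable def decayingSolution (l : ℂ) (R : ℂ → ℂ) (x : ℂ) : ℂ :=
  -∫ t in Ioi (0 : ℝ), Complex.exp (-l * t) * R (x + t)

section DecayingSolution

variable {S : Set ℂ} {R : ℂ → ℂ} {M ν : ℝ} {l : ℂ}

lemma norm_exp_neg_mul_ofReal (hl : l.re = 0) (t : ℝ) : ‖Complex.exp (-l * t)‖ = 1 := by
  simp [Complex.norm_exp, hl]

lemma integrableOn_const_mul_exp (hν : 0 < ν) (C : ℝ) :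
    IntegrableOn (fun t : ℝ => C * Real.exp (-ν * t)) (Ioi 0) :=
  (integrableOn_exp_mul_Ioi (neg_lt_zero.2 hν) 0).const_mul C

lemma continuousOn_exp_mul_translate {f : ℂ → ℂ} (hf : ContinuousOn f S)
    (hadd : ∀ x ∈ S, ∀ t : ℝ, 0 ≤ t → x + t ∈ S) {x : ℂ} (hx : x ∈ S) :
    ContinuousOn (fun t : ℝ => Complex.exp (-l * t) * f (x + t)) (Ioi 0) := by
  refine ContinuousOn.mul (by fun_prop) (hf.comp (by fun_prop) fun t ht => ?_)
  exact hadd x hx t (le_of_lt ht)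

lemma norm_exp_mul_translate_le (hl : l.re = 0)
    (hadd : ∀ x ∈ S, ∀ t : ℝ, 0 ≤ t → x + t ∈ S)
    (hb : ∀ x ∈ S, ‖R x‖ ≤ M * Real.exp (-ν * x.re)) {x : ℂ} (hx : x ∈ S) {t : ℝ}
    (ht : 0 ≤ t) :
    ‖Complex.exp (-l * t) * R (x + t)‖ ≤ M * Real.exp (-ν * x.re) * Real.exp (-ν * t) := by
  rw [norm_mul, norm_exp_neg_mul_ofReal hl, one_mul, mul_assoc, ← Real.exp_add]
  refine (hb _ (hadd x hx t ht)).trans_eq ?_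
  simp [mul_add]

lemma integrableOn_exp_mul_translate (hν : 0 < ν) (hl : l.re = 0)
    (hR : ContinuousOn R S) (hadd : ∀ x ∈ S, ∀ t : ℝ, 0 ≤ t → x + t ∈ S)
    (hb : ∀ x ∈ S, ‖R x‖ ≤ M * Real.exp (-ν * x.re)) {x : ℂ} (hx : x ∈ S) :
    IntegrableOn (fun t : ℝ => Complex.exp (-l * t) * R (x + t)) (Ioi 0) := by
  refine (integrableOn_const_mul_exp hν (M * Real.exp (-ν * x.re))).mono'
    ((continuousOn_exp_mul_translate hR hadd hx).aestronglyMeasurable measurableSet_Ioi) ?_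
  filter_upwards [ae_restrict_mem measurableSet_Ioi] with t ht
  exact norm_exp_mul_translate_le hl hadd hb hx (le_of_lt ht)

lemma norm_decayingSolution_le (hν : 0 < ν) (hl : l.re = 0)
    (hadd : ∀ x ∈ S, ∀ t : ℝ, 0 ≤ t → x + t ∈ S)
    (hb : ∀ x ∈ S, ‖R x‖ ≤ M * Real.exp (-ν * x.re)) {x : ℂ} (hx : x ∈ S) :
    ‖decayingSolution l R x‖ ≤ M * Real.exp (-ν * x.re) * ν⁻¹ := by
  rw [decayingSolution, norm_neg]
  refine (norm_integral_le_of_norm_le (integrableOn_const_mul_exp hν (M * Real.exp (-ν * x.re)))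
    ?_).trans_eq ?_
  · filter_upwards [ae_restrict_mem measurableSet_Ioi] with t ht
    exact norm_exp_mul_translate_le hl hadd hb hx (le_of_lt ht)
  · rw [integral_const_mul, integral_exp_mul_Ioi (neg_lt_zero.2 hν)]
    simp

lemma norm_deriv_le_of_closedBall_subset (hM : 0 ≤ M) (hν : 0 < ν) (hR : DifferentiableOn ℂ R S)
    (hb : ∀ x ∈ S, ‖R x‖ ≤ M * Real.exp (-ν * x.re)) {x : ℂ} {r : ℝ} (hr : 0 < r)
    (hx : Metric.closedBall x r ⊆ S) :
    ‖deriv R x‖ ≤ M * Real.exp (-ν * (x.re - r)) / r := by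
  refine Complex.norm_deriv_le_of_forall_mem_sphere_norm_le hr
    ((hR.mono hx).diffContOnCl_ball subset_rfl) fun z hz => ?_
  refine (hb z (hx (Metric.sphere_subset_closedBall hz))).trans ?_
  have h : |(x - z).re| ≤ r := (Complex.abs_re_le_norm _).trans_eq
    (by rw [← dist_eq_norm, dist_comm]; exact hz)
  have h' : x.re - r ≤ z.re := by
    have := (abs_le.1 h).2
    simp only [Complex.sub_re] at this
    linarith
  gcongr M * Real.exp ?_
  nlinarith

lemma hasDerivAt_decayingSolution (hM : 0 ≤ M) (hν : 0 < ν) (hl : l.re = 0) (hS : IsOpen S)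
    (hR : DifferentiableOn ℂ R S) (hadd : ∀ x ∈ S, ∀ t : ℝ, 0 ≤ t → x + t ∈ S)
    (hb : ∀ x ∈ S, ‖R x‖ ≤ M * Real.exp (-ν * x.re)) {x : ℂ} (hx : x ∈ S) :
    HasDerivAt (decayingSolution l R) (l * decayingSolution l R x + R x) x := by
  obtain ⟨r, hr, hball⟩ : ∃ r > 0, Metric.closedBall x (2 * r) ⊆ S := by
    obtain ⟨e, he, h⟩ := Metric.nhds_basis_closedBall.mem_iff.1 (hS.mem_nhds hx)
    exact ⟨e / 2, by positivity, by rwa [mul_div_cancel₀ _ two_ne_zero]⟩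
  have hderiv : ∀ y ∈ S, ∀ t : ℝ, 0 ≤ t → HasDerivAt R (deriv R (y + t)) (y + t) :=
    fun y hy t ht => (hR.differentiableAt (hS.mem_nhds (hadd y hy t ht))).hasDerivAt
  have hbS : Metric.ball x r ⊆ S := fun y hy => hball
    (Metric.closedBall_subset_closedBall (by linarith) (Metric.ball_subset_closedBall hy))
  have key := hasDerivAt_integral_of_dominated_loc_of_deriv_le (μ := volume.restrict (Ioi (0 : ℝ)))
    (F := fun y (t : ℝ) => Complex.exp (-l * t) * R (y + t))
    (F' := fun y (t : ℝ) => Complex.exp (-l * t) * deriv R (y + t)) (x₀ := x)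
    (bound := fun t => M * Real.exp (-ν * (x.re - 2 * r)) / r * Real.exp (-ν * t))
    (Metric.ball_mem_nhds x hr)
    (by
      filter_upwards [hS.mem_nhds hx] with y hy
      exact (continuousOn_exp_mul_translate hR.continuousOn hadd hy).aestronglyMeasurable
        measurableSet_Ioi)
    (integrableOn_exp_mul_translate hν hl hR.continuousOn hadd hb hx)
    ((continuousOn_exp_mul_translate (hR.deriv hS).continuousOn hadd hx).aestronglyMeasurable
        measurableSet_Ioi)
    (by
      filter_upwards [ae_restrict_mem measurableSet_Ioi] with t ht y hy
      rw [norm_mul, norm_exp_neg_mul_ofReal hl, one_mul]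
      have hsub : Metric.closedBall (y + t) r ⊆ S := by
        intro z hz
        have : z - t ∈ S := by
          apply hball
          rw [Metric.mem_closedBall, dist_eq_norm] at hz ⊢
          rw [Metric.mem_ball, dist_eq_norm] at hy
          calc ‖z - t - x‖ = ‖(z - (y + t)) + (y - x)‖ := by ring_nf
            _ ≤ 2 * r := (norm_add_le _ _).trans (by linarith)
        simpa using hadd _ this t (le_of_lt ht)
      refine (norm_deriv_le_of_closedBall_subset hM hν hR hb hr hsub).trans ?_
      have hre : x.re - r ≤ y.re := by
        have h1 : |(y - x).re| ≤ r := (Complex.abs_re_le_norm _).trans (by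
          rw [← dist_eq_norm]; exact (Metric.mem_ball.1 hy).le)
        have := (abs_le.1 h1).1
        simp only [Complex.sub_re] at this
        linarith
      rw [div_mul_eq_mul_div, mul_assoc, ← Real.exp_add]
      gcongr
      simp only [Complex.add_re, Complex.ofReal_re]
      nlinarith)
    (integrableOn_const_mul_exp hν _)
    (by
      filter_upwards [ae_restrict_mem measurableSet_Ioi] with t ht y hy
      exact ((hderiv y (hbS hy) t (le_of_lt ht)).comp_add_const y (t : ℂ)).const_mul _)
  have hint := integrableOn_exp_mul_translate hν hl hR.continuousOn hadd hb hx
  have hparts := integral_Ioi_of_hasDerivAt_of_tendsto' (a := 0) (m := 0)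
    (f := fun t : ℝ => Complex.exp (-l * t) * R (x + t))
    (f' := fun t : ℝ => -l * (Complex.exp (-l * t) * R (x + t)) +
      Complex.exp (-l * t) * deriv R (x + t))
    (fun t ht => by
      have h1 : HasDerivAt (fun z : ℂ => Complex.exp (-l * z)) (Complex.exp (-l * t) * -l) t := by
        simpa using ((hasDerivAt_id (t : ℂ)).const_mul (-l)).cexp
      have h2 := (hderiv x hx t ht).comp_const_add x (t : ℂ)
      refine (h1.mul h2).comp_ofReal.congr_deriv ?_
      ring)
    ((hint.const_mul _).add key.1)
    (by
      have h0 : Tendsto (fun t : ℝ => M * Real.exp (-ν * x.re) * Real.exp (-ν * t)) atTop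
          (𝓝 0) := by
        simpa using (Real.tendsto_exp_atBot.comp
          (tendsto_id.const_mul_atTop_of_neg (neg_lt_zero.2 hν))).const_mul
            (M * Real.exp (-ν * x.re))
      refine squeeze_zero_norm' ?_ h0
      filter_upwards [eventually_ge_atTop 0] with t ht
      exact norm_exp_mul_translate_le hl hadd hb hx ht)
  rw [integral_add (hint.const_mul _) key.1, integral_const_mul] at hparts
  refine key.2.neg.congr_deriv ?_
  simp only [Complex.ofReal_zero, mul_zero, Complex.exp_zero, add_zero, one_mul] at hparts
  rw [decayingSolution]
  linear_combination -hparts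

end DecayingSolution


/-- Solvability with decay of `B'' − 2iα·B' − β²·B = R` on the semi-infinite strip
`S_ρ̂ = {x : Re x > −ρ̂, |Im x| < ρ̂}`, case `0 < β < α` of real characteristic exponent splitting,
`γ = √(α² − β²)`: there is a holomorphic solution `B` with
`|B(x)| ≤ 8M e^{(α+2ν)ρ̂ + γ} (νγ)⁻¹ e^{−ν Re(x)/2}` and
`|B'(x)| ≤ 16M(2+α) e^{(α+2ν)ρ̂ + γ} max(1, γ⁻¹) ν⁻¹ e^{−ν Re(x)/2}`. -/
theorem ode_solvability_case_beta_lt_alpha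
    (ν ρ : ℝ) (hν : ν ∈ Set.Ioc (0:ℝ) 1) (hρ : ρ ∈ Set.Ioc (0:ℝ) 1)
    (α β M : ℝ) (hα : 0 < α) (hβ0 : 0 < β) (hβ : β < α) (hM : 0 ≤ M)
    (γ : ℝ) (hγ : γ = Real.sqrt (α ^ 2 - β ^ 2))
    (S : Set ℂ) (hS : S = {x : ℂ | -ρ < x.re ∧ |x.im| < ρ})
    (R : ℂ → ℂ) (hR : DifferentiableOn ℂ R S)
    (hRbound : ∀ x ∈ S, ‖R x‖ ≤ M * Real.exp (-ν * ‖x‖)) :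
    ∃ B : ℂ → ℂ, DifferentiableOn ℂ B S ∧
      (∀ x ∈ S,
        deriv (deriv B) x - 2 * Complex.I * α * deriv B x - (β : ℂ) ^ 2 * B x = R x) ∧
      (∀ x ∈ S, ‖B x‖ ≤
        8 * M * Real.exp ((α + 2 * ν) * ρ + γ) * (ν * γ)⁻¹ * Real.exp (-ν * x.re / 2)) ∧
      (∀ x ∈ S, ‖deriv B x‖ ≤
        16 * M * (2 + α) * Real.exp ((α + 2 * ν) * ρ + γ) * max 1 γ⁻¹ * ν⁻¹ *
          Real.exp (-ν * x.re / 2)) := by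
  obtain ⟨hν0, hν1⟩ := hν
  obtain ⟨hρ0, hρ1⟩ := hρ
  have hsq : 0 < α ^ 2 - β ^ 2 := by nlinarith
  have hγ0 : 0 < γ := hγ ▸ Real.sqrt_pos.2 hsq
  have hγ2 : γ ^ 2 = α ^ 2 - β ^ 2 := by rw [hγ, Real.sq_sqrt hsq.le]
  have hγα : γ ≤ α := by nlinarith
  have hSo : IsOpen S := by
    rw [hS]
    exact (isOpen_lt continuous_const Complex.continuous_re).inter
      (isOpen_lt Complex.continuous_im.abs continuous_const)
  have hadd : ∀ x ∈ S, ∀ t : ℝ, 0 ≤ t → x + t ∈ S := by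
    rw [hS]
    rintro x ⟨h1, h2⟩ t ht
    exact ⟨by simp only [Complex.add_re, Complex.ofReal_re]; linarith, by simpa using h2⟩
  have hb : ∀ x ∈ S, ‖R x‖ ≤ M * Real.exp (-ν * x.re) := fun x hx => by
    refine (hRbound x hx).trans ?_
    gcongr ?_ * Real.exp ?_
    nlinarith [Complex.re_le_norm x]
  obtain ⟨l₁, hl₁⟩ : ∃ l : ℂ, l = ((α + γ : ℝ) : ℂ) * Complex.I := ⟨_, rfl⟩
  obtain ⟨l₂, hl₂⟩ : ∃ l : ℂ, l = ((α - γ : ℝ) : ℂ) * Complex.I := ⟨_, rfl⟩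
  have hre₁ : l₁.re = 0 := by simp [hl₁]
  have hre₂ : l₂.re = 0 := by simp [hl₂]
  have hn₁ : ‖l₁‖ = α + γ := by
    rw [hl₁, norm_mul, Complex.norm_I, mul_one, Complex.norm_real, Real.norm_of_nonneg (by linarith)]
  have hn₂ : ‖l₂‖ = α - γ := by
    rw [hl₂, norm_mul, Complex.norm_I, mul_one, Complex.norm_real, Real.norm_of_nonneg (by linarith)]
  have hsub : l₁ - l₂ = ((2 * γ : ℝ) : ℂ) * Complex.I := by rw [hl₁, hl₂]; push_cast; ring
  have hnsub : ‖(l₁ - l₂)⁻¹‖ = (2 * γ)⁻¹ := by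
    rw [norm_inv, hsub, norm_mul, Complex.norm_I, mul_one, Complex.norm_real,
      Real.norm_of_nonneg (by linarith)]
  have hne : l₁ - l₂ ≠ 0 := by
    rw [hsub]
    exact mul_ne_zero (Complex.ofReal_ne_zero.2 (by positivity)) Complex.I_ne_zero
  have hsum : l₁ + l₂ = 2 * Complex.I * α := by rw [hl₁, hl₂]; push_cast; ring
  have hprod : l₁ * l₂ = -(β : ℂ) ^ 2 := by
    have : (γ : ℂ) ^ 2 = α ^ 2 - β ^ 2 := by exact_mod_cast hγ2
    rw [hl₁, hl₂]
    push_cast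
    linear_combination (α ^ 2 - γ ^ 2 : ℂ) * Complex.I_sq + this
  let u₁ := decayingSolution l₁ R
  let u₂ := decayingSolution l₂ R
  have hd₁ : ∀ x ∈ S, HasDerivAt u₁ (l₁ * u₁ x + R x) x := fun x hx =>
    hasDerivAt_decayingSolution hM hν0 hre₁ hSo hR hadd hb hx
  have hd₂ : ∀ x ∈ S, HasDerivAt u₂ (l₂ * u₂ x + R x) x := fun x hx =>
    hasDerivAt_decayingSolution hM hν0 hre₂ hSo hR hadd hb hx
  have hB : ∀ x ∈ S, HasDerivAt (fun x => (l₁ - l₂)⁻¹ * (u₁ x - u₂ x))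
      ((l₁ - l₂)⁻¹ * (l₁ * u₁ x - l₂ * u₂ x)) x := fun x hx =>
    (((hd₁ x hx).sub (hd₂ x hx)).const_mul (l₁ - l₂)⁻¹).congr_deriv (by ring)
  have hB' : ∀ x ∈ S, HasDerivAt (deriv fun x => (l₁ - l₂)⁻¹ * (u₁ x - u₂ x))
      ((l₁ - l₂)⁻¹ * (l₁ * (l₁ * u₁ x + R x) - l₂ * (l₂ * u₂ x + R x))) x := fun x hx =>
    ((((hd₁ x hx).const_mul l₁).sub ((hd₂ x hx).const_mul l₂)).const_mul
      (l₁ - l₂)⁻¹).congr_of_eventuallyEq (by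
        filter_upwards [hSo.mem_nhds hx] with y hy
        exact (hB y hy).deriv)
  have hu : ∀ x ∈ S, ∀ l : ℂ, l.re = 0 → ‖decayingSolution l R x‖ ≤
      M * ν⁻¹ * (Real.exp ((α + 2 * ν) * ρ + γ) * Real.exp (-ν * x.re / 2)) := by
    intro x hx l hl
    refine (norm_decayingSolution_le hν0 hl hadd hb hx).trans ?_
    have hxρ : -ρ < x.re := by rw [hS] at hx; exact hx.1
    rw [mul_right_comm, ← Real.exp_add]
    gcongr
    nlinarith [mul_pos hα hρ0, mul_pos hν0 hρ0]
  refine ⟨fun x => (l₁ - l₂)⁻¹ * (u₁ x - u₂ x),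
    fun x hx => (hB x hx).differentiableAt.differentiableWithinAt, fun x hx => ?_,
    fun x hx => ?_, fun x hx => ?_⟩
  · rw [(hB' x hx).deriv, (hB x hx).deriv, ← hsum]
    have : (β : ℂ) ^ 2 = -(l₁ * l₂) := by rw [hprod, neg_neg]
    rw [this]
    field_simp
    ring
  · rw [norm_mul, hnsub]
    have h1 := hu x hx l₁ hre₁
    have h2 := hu x hx l₂ hre₂
    set E := Real.exp ((α + 2 * ν) * ρ + γ) * Real.exp (-ν * x.re / 2) with hE
    have hE0 : 0 < E := by positivity
    calc (2 * γ)⁻¹ * ‖u₁ x - u₂ x‖ ≤ (2 * γ)⁻¹ * (M * ν⁻¹ * E + M * ν⁻¹ * E) := by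
          gcongr
          exact (norm_sub_le _ _).trans (add_le_add h1 h2)
      _ = 1 * (M * (ν * γ)⁻¹ * E) := by field_simp; ring
      _ ≤ 8 * (M * (ν * γ)⁻¹ * E) := by gcongr; norm_num
      _ = _ := by rw [hE]; ring
  · rw [(hB x hx).deriv, norm_mul, hnsub]
    have h1 := hu x hx l₁ hre₁
    have h2 := hu x hx l₂ hre₂
    set E := Real.exp ((α + 2 * ν) * ρ + γ) * Real.exp (-ν * x.re / 2) with hE
    have hE0 : 0 < E := by positivity
    calc (2 * γ)⁻¹ * ‖l₁ * u₁ x - l₂ * u₂ x‖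
        ≤ (2 * γ)⁻¹ * ((α + γ) * (M * ν⁻¹ * E) + (α - γ) * (M * ν⁻¹ * E)) := by
          gcongr
          refine (norm_sub_le _ _).trans (add_le_add ?_ ?_)
          · rw [norm_mul, hn₁]
            gcongr
          · rw [norm_mul, hn₂]
            exact mul_le_mul_of_nonneg_left h2 (by linarith)
      _ = α * γ⁻¹ * (M * ν⁻¹ * E) := by field_simp; ring
      _ ≤ (16 * (2 + α)) * max 1 γ⁻¹ * (M * ν⁻¹ * E) := by
          gcongr
          · linarith
          · exact le_max_right _ _
      _ = _ := by rw [hE]; ring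
end

section
/- Let ν, ρ̂ ∈ (0,1], α > 0, M ≥ 0, and let R : ℂ → ℂ be holomorphic on the strip S_ρ̂ with |R(x)| ≤ M·e^{−ν|x|} for all x ∈ S_ρ̂. Then there exists a holomorphic function B : S_ρ̂ → ℂ such that B''(x) − 2iα·B'(x) − α²·B(x) = R(x) for all x ∈ S_ρ̂, and moreover |B(x)| ≤ 32·M·(1+α)·ν^{−3}·e^{(α+2ν)ρ̂}·e^{−ν·Re(x)/2} and |B'(x)| ≤ 32·M·(1+α)·ν^{−3}·e^{(α+2ν)ρ̂}·e^{−ν·Re(x)/2} for all x ∈ S_ρ̂. -/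
open MeasureTheory Filter Topology Set Metric in
/-- On an open set `S` invariant under translation to the right, the horizontal tail integral of a
holomorphic function decaying like `e^{-c Re x + a Im x}` is minus a primitive of the function and
decays at the same rate. -/
theorem Complex.hasDerivAt_integral_Ioi_add {S : Set ℂ} (hS : IsOpen S)
    (hadd : ∀ x ∈ S, ∀ t : ℝ, 0 ≤ t → x + t ∈ S) {f : ℂ → ℂ} (hf : DifferentiableOn ℂ f S)
    {c a K : ℝ} (hc : 0 < c)
    (hb : ∀ x ∈ S, ‖f x‖ ≤ K * Real.exp (-c * x.re + a * x.im)) {x : ℂ} (hx : x ∈ S) :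
    HasDerivAt (fun z : ℂ => ∫ t in Ioi (0 : ℝ), f (z + t)) (-f x) x ∧
      ‖∫ t in Ioi (0 : ℝ), f (x + t)‖ ≤ K / c * Real.exp (-c * x.re + a * x.im) := by
  have hK : 0 ≤ K := nonneg_of_mul_nonneg_left ((norm_nonneg _).trans (hb x hx)) (Real.exp_pos _)
  have hbt : ∀ z ∈ S, ∀ t : ℝ, 0 ≤ t →
      ‖f (z + t)‖ ≤ K * Real.exp (-c * z.re + a * z.im) * Real.exp (-c * t) := by
    intro z hz t ht
    refine (hb _ (hadd z hz t ht)).trans_eq ?_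
    rw [mul_assoc, ← Real.exp_add]
    simp only [Complex.add_re, Complex.add_im, Complex.ofReal_re, Complex.ofReal_im]
    ring_nf
  have hexp : IntegrableOn (fun t : ℝ => Real.exp (-c * t)) (Ioi 0) :=
    exp_neg_integrableOn_Ioi 0 hc
  have hmeas : ∀ g : ℂ → ℂ, ContinuousOn g S → ∀ z ∈ S,
      AEStronglyMeasurable (fun t : ℝ => g (z + t)) (volume.restrict (Ioi 0)) := by
    intro g hg z hz
    refine ContinuousOn.aestronglyMeasurable ?_ measurableSet_Ioi
    exact hg.comp (by fun_prop) fun t ht => hadd z hz t (le_of_lt ht)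
  have hint : ∀ z ∈ S, IntegrableOn (fun t : ℝ => f (z + t)) (Ioi 0) := by
    intro z hz
    refine (hexp.const_mul (K * Real.exp (-c * z.re + a * z.im))).mono'
      (hmeas f hf.continuousOn z hz) ?_
    filter_upwards [ae_restrict_mem measurableSet_Ioi] with t ht
    exact hbt z hz t (le_of_lt ht)
  have hdiff : ∀ z ∈ S, HasDerivAt f (deriv f z) z := fun z hz =>
    (hf.differentiableAt (hS.mem_nhds hz)).hasDerivAt
  obtain ⟨r, hr, hball⟩ : ∃ r > 0, closedBall x (r + r) ⊆ S := by
    obtain ⟨ε, hε, h⟩ := nhds_basis_closedBall.mem_iff.1 (hS.mem_nhds hx)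
    exact ⟨ε / 2, by positivity, by simpa using h⟩
  have hre : ∀ z ∈ closedBall x (r + r),
      -c * z.re + a * z.im ≤ -c * x.re + a * x.im + (c + |a|) * (r + r) := by
    intro z hz
    have hz' : ‖z - x‖ ≤ r + r := by simpa [dist_eq_norm] using hz
    have h1 := ((Complex.abs_re_le_norm (z - x)).trans hz')
    have h2 := ((Complex.abs_im_le_norm (z - x)).trans hz')
    have h3 : a * (z - x).im ≤ |a| * (r + r) :=
      (le_abs_self _).trans (by rw [abs_mul]; gcongr)
    rw [Complex.sub_im] at h3
    rw [Complex.sub_re] at h1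
    nlinarith [(abs_le.1 h1).1]
  set C : ℝ := K * Real.exp (-c * x.re + a * x.im + (c + |a|) * (r + r)) with hC
  have hderiv : ∀ t : ℝ, 0 ≤ t → ∀ z ∈ ball x r,
      ‖deriv f (z + t)‖ ≤ C / r * Real.exp (-c * t) := by
    intro t ht z hz
    have hmem : ∀ y ∈ closedBall (z + t) r, y - t ∈ closedBall x (r + r) := by
      intro y hy
      rw [mem_closedBall] at hy ⊢
      rw [mem_ball] at hz
      have : dist (y - t) z ≤ r := by
        rw [dist_eq_norm] at hy ⊢
        rwa [sub_sub, add_comm (t : ℂ)]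
      linarith [dist_triangle (y - t) z x]
    have hsub : closedBall (z + t) r ⊆ S := by
      intro y hy
      simpa using hadd _ (hball (hmem y hy)) t ht
    rw [div_mul_eq_mul_div]
    refine Complex.norm_deriv_le_of_forall_mem_sphere_norm_le hr
      (DifferentiableOn.diffContOnCl (hf.mono (closure_ball_subset_closedBall.trans hsub))) ?_
    intro y hy
    have hy' := hmem y (sphere_subset_closedBall hy)
    have h := hbt _ (hball hy') t ht
    rw [sub_add_cancel] at h
    refine h.trans ?_
    rw [hC]
    gcongr K * ?_ * _
    exact Real.exp_le_exp.2 (hre _ hy')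
  constructor
  · have key := hasDerivAt_integral_of_dominated_loc_of_deriv_le
      (μ := volume.restrict (Ioi (0 : ℝ))) (F := fun z t => f (z + (t : ℂ)))
      (F' := fun z t => deriv f (z + (t : ℂ))) (x₀ := x) (s := ball x r)
      (bound := fun t => C / r * Real.exp (-c * t)) (ball_mem_nhds x hr)
      (by
        filter_upwards [hS.mem_nhds hx] with z hz using hmeas f hf.continuousOn z hz)
      (hint x hx) (hmeas _ (hf.deriv hS).continuousOn x hx)
      (by
        filter_upwards [ae_restrict_mem measurableSet_Ioi] with t ht
        exact hderiv t (le_of_lt ht))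
      (hexp.const_mul _)
      (by
        filter_upwards [ae_restrict_mem measurableSet_Ioi] with t ht z hz
        have hz' : z ∈ S := hball (closedBall_subset_closedBall (by linarith)
          (ball_subset_closedBall hz))
        exact (hdiff _ (hadd z hz' t (le_of_lt ht))).comp_add_const z t)
    have hlim : Tendsto (fun t : ℝ => f (x + t)) atTop (𝓝 0) := by
      refine squeeze_zero_norm' (a := fun t : ℝ =>
        K * Real.exp (-c * x.re + a * x.im) * Real.exp (-c * t)) ?_ ?_
      · filter_upwards [eventually_ge_atTop 0] with t ht using hbt x hx t ht
      · have h : Tendsto (fun t : ℝ => Real.exp (-c * t)) atTop (𝓝 0) :=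
          Real.tendsto_exp_atBot.comp (tendsto_id.const_mul_atTop_of_neg (neg_neg_of_pos hc))
        simpa using h.const_mul (K * Real.exp (-c * x.re + a * x.im))
    have hftc := integral_Ioi_of_hasDerivAt_of_tendsto' (a := 0)
      (f := fun t : ℝ => f (x + t)) (f' := fun t : ℝ => deriv f (x + t))
      (fun t ht => ((hdiff _ (hadd x hx t ht)).comp_const_add x t).comp_ofReal) key.1 hlim
    simpa [hftc] using key.2
  · refine (norm_integral_le_of_norm_le
      (hexp.const_mul (K * Real.exp (-c * x.re + a * x.im))) ?_).trans_eq ?_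
    · filter_upwards [ae_restrict_mem measurableSet_Ioi] with t ht using hbt x hx t (le_of_lt ht)
    · rw [integral_const_mul, integral_exp_mul_Ioi (neg_neg_of_pos hc)]
      simp
      ring


/-- Solvability with decay of `B'' − 2iα·B' − α²·B = R` on the semi-infinite strip
`S_ρ̂ = {x : Re x > −ρ̂, |Im x| < ρ̂}`, resonant case `β = α` (double characteristic
root `iα`): there is a holomorphic solution `B` with
`|B(x)|, |B'(x)| ≤ 32M(1+α) ν⁻³ e^{(α+2ν)ρ̂} e^{−ν Re(x)/2}`. -/
theorem ode_solvability_case_beta_eq_alpha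
    (ν ρ : ℝ) (hν : ν ∈ Set.Ioc (0:ℝ) 1) (hρ : ρ ∈ Set.Ioc (0:ℝ) 1)
    (α M : ℝ) (hα : 0 < α) (hM : 0 ≤ M)
    (S : Set ℂ) (hS : S = {x : ℂ | -ρ < x.re ∧ |x.im| < ρ})
    (R : ℂ → ℂ) (hR : DifferentiableOn ℂ R S)
    (hRbound : ∀ x ∈ S, ‖R x‖ ≤ M * Real.exp (-ν * ‖x‖)) :
    ∃ B : ℂ → ℂ, DifferentiableOn ℂ B S ∧
      (∀ x ∈ S,
        deriv (deriv B) x - 2 * Complex.I * α * deriv B x - (α : ℂ) ^ 2 * B x = R x) ∧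
      (∀ x ∈ S, ‖B x‖ ≤
        32 * M * (1 + α) * ν⁻¹ ^ 3 * Real.exp ((α + 2 * ν) * ρ) *
          Real.exp (-ν * x.re / 2)) ∧
      (∀ x ∈ S, ‖deriv B x‖ ≤
        32 * M * (1 + α) * ν⁻¹ ^ 3 * Real.exp ((α + 2 * ν) * ρ) *
          Real.exp (-ν * x.re / 2)) := by
  obtain ⟨hν0, hν1⟩ := hν
  obtain ⟨hρ0, hρ1⟩ := hρ
  have hopen : IsOpen S := by
    rw [hS]
    exact (isOpen_lt continuous_const Complex.continuous_re).inter
      (isOpen_lt Complex.continuous_im.abs continuous_const)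
  have hadd : ∀ x ∈ S, ∀ t : ℝ, 0 ≤ t → x + t ∈ S := by
    intro x hx t ht
    rw [hS] at hx ⊢
    exact ⟨by simpa using by linarith [hx.1], by simpa using hx.2⟩
  have hnorm : ∀ x : ℂ, ‖Complex.exp (-(Complex.I * α * x))‖ = Real.exp (α * x.im) := by
    intro x
    simp [Complex.norm_exp]
  have hnorm' : ∀ x : ℂ, ‖Complex.exp (Complex.I * α * x)‖ = Real.exp (-(α * x.im)) := by
    intro x
    simp [Complex.norm_exp]
  have hE : ∀ x : ℂ, HasDerivAt (fun z => Complex.exp (Complex.I * α * z))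
      (Complex.I * α * Complex.exp (Complex.I * α * x)) x := by
    intro x
    simpa [mul_comm] using ((hasDerivAt_id x).const_mul (Complex.I * α)).cexp
  set f : ℂ → ℂ := fun z => Complex.exp (-(Complex.I * α * z)) * R z with hf
  have hfd : DifferentiableOn ℂ f S := by
    refine DifferentiableOn.mul (Differentiable.differentiableOn ?_) hR
    fun_prop
  have hfb : ∀ x ∈ S, ‖f x‖ ≤ M * Real.exp (-ν * x.re + α * x.im) := by
    intro x hx
    rw [hf, norm_mul, hnorm, Real.exp_add, ← mul_assoc, mul_comm]
    gcongr
    refine (hRbound x hx).trans ?_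
    gcongr M * Real.exp ?_
    nlinarith [Complex.re_le_norm x]
  set G : ℂ → ℂ := fun z => ∫ t in Set.Ioi (0 : ℝ), f (z + t) with hG
  have hGd : ∀ x ∈ S, HasDerivAt G (-f x) x := fun x hx =>
    (Complex.hasDerivAt_integral_Ioi_add hopen hadd hfd hν0 hfb hx).1
  have hGb : ∀ x ∈ S, ‖G x‖ ≤ M / ν * Real.exp (-ν * x.re + α * x.im) := fun x hx =>
    (Complex.hasDerivAt_integral_Ioi_add hopen hadd hfd hν0 hfb hx).2
  have hGdo : DifferentiableOn ℂ G S := fun x hx =>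
    (hGd x hx).differentiableAt.differentiableWithinAt
  set H : ℂ → ℂ := fun z => ∫ t in Set.Ioi (0 : ℝ), G (z + t) with hH
  have hHd : ∀ x ∈ S, HasDerivAt H (-G x) x := fun x hx =>
    (Complex.hasDerivAt_integral_Ioi_add hopen hadd hGdo hν0 hGb hx).1
  have hHb : ∀ x ∈ S, ‖H x‖ ≤ M / ν / ν * Real.exp (-ν * x.re + α * x.im) := fun x hx =>
    (Complex.hasDerivAt_integral_Ioi_add hopen hadd hGdo hν0 hGb hx).2
  set B : ℂ → ℂ := fun z => Complex.exp (Complex.I * α * z) * H z with hB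
  have hBd : ∀ x ∈ S, HasDerivAt B
      (Complex.exp (Complex.I * α * x) * (Complex.I * α * H x - G x)) x := by
    intro x hx
    refine ((hE x).mul (hHd x hx)).congr_deriv ?_
    ring
  have hBd2 : ∀ x ∈ S, HasDerivAt (deriv B)
      (Complex.I * α * Complex.exp (Complex.I * α * x) * (Complex.I * α * H x - G x) +
        Complex.exp (Complex.I * α * x) * (Complex.I * α * (-G x) - (-f x))) x := by
    intro x hx
    refine ((hE x).mul (((hHd x hx).const_mul (Complex.I * α)).sub
      (hGd x hx))).congr_of_eventuallyEq ?_
    filter_upwards [hopen.mem_nhds hx] with z hz using (hBd z hz).deriv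
  have hcancel : ∀ (x : ℂ) (L : ℝ),
      Real.exp (-(α * x.im)) * (L * Real.exp (-ν * x.re + α * x.im)) =
        L * Real.exp (-ν * x.re) := by
    intro x L
    rw [mul_left_comm, ← Real.exp_add]
    ring_nf
  have hfinal : ∀ x ∈ S, ∀ L : ℝ, L ≤ M * (1 + α) * ν⁻¹ ^ 3 → L * Real.exp (-ν * x.re) ≤
      32 * M * (1 + α) * ν⁻¹ ^ 3 * Real.exp ((α + 2 * ν) * ρ) * Real.exp (-ν * x.re / 2) := by
    intro x hx L hL
    rw [hS] at hx
    have hD : 0 ≤ M * (1 + α) * ν⁻¹ ^ 3 := by positivity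
    rw [mul_assoc _ (Real.exp _), ← Real.exp_add]
    have hexp : -ν * x.re ≤ (α + 2 * ν) * ρ + -ν * x.re / 2 := by
      nlinarith [hx.1, mul_pos hα hρ0, mul_pos hν0 hρ0]
    refine mul_le_mul (by linarith) (Real.exp_le_exp.2 hexp) (Real.exp_pos _).le (by linarith)
  have hν' : 1 ≤ ν⁻¹ := (one_le_inv₀ hν0).2 hν1
  have h23 : ν⁻¹ ^ 2 ≤ ν⁻¹ ^ 3 := pow_le_pow_right₀ hν' (by norm_num)
  have h13 : ν⁻¹ ≤ ν⁻¹ ^ 3 := le_self_pow₀ hν' (by norm_num)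
  refine ⟨B, fun x hx => (hBd x hx).differentiableAt.differentiableWithinAt, ?_, ?_, ?_⟩
  · intro x hx
    have hR' : Complex.exp (Complex.I * α * x) * f x = R x := by
      rw [hf, ← mul_assoc, ← Complex.exp_add]
      simp
    rw [(hBd2 x hx).deriv, (hBd x hx).deriv, ← hR', hB]
    linear_combination
      (-(α : ℂ) ^ 2 * Complex.exp (Complex.I * α * x) * H x) * Complex.I_sq
  · intro x hx
    refine le_trans ?_ (hfinal x hx (M / ν / ν) ?_)
    · rw [← hcancel, hB, norm_mul, hnorm']
      gcongr
      exact hHb x hx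
    · calc M / ν / ν = M * 1 * ν⁻¹ ^ 2 := by ring
        _ ≤ M * (1 + α) * ν⁻¹ ^ 3 := by gcongr; linarith
  · intro x hx
    rw [(hBd x hx).deriv]
    refine le_trans ?_ (hfinal x hx (α * (M / ν / ν) + M / ν) ?_)
    · rw [← hcancel, norm_mul, hnorm']
      gcongr
      refine (norm_sub_le _ _).trans ?_
      rw [add_mul, mul_assoc α]
      refine add_le_add ?_ (hGb x hx)
      rw [norm_mul, norm_mul, Complex.norm_I, one_mul, Complex.norm_of_nonneg hα.le]
      gcongr
      exact hHb x hx
    · calc α * (M / ν / ν) + M / ν = M * α * ν⁻¹ ^ 2 + M * ν⁻¹ := by ring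
        _ ≤ M * α * ν⁻¹ ^ 3 + M * ν⁻¹ ^ 3 := by gcongr
        _ = M * (1 + α) * ν⁻¹ ^ 3 := by ring
end

section
/- Let ν, ρ̂ ∈ (0,1], α > 0, β > 0, M ≥ 0, and define δ ∈ ℂ by δ := √(β² − α²) if β ≥ α and δ := i·√(α² − β²) if β < α. Let δ₋ ∈ (0,1] be such that δ₋ ≤ |δ| whenever δ ≠ 0, and let δ₊ ≥ 0 be such that |δ| ≤ δ₊ whenever β < α. Set 𝔊 := 64·(2+α)·e^{α+2ν+δ₊}·δ₋^{−1}·ν^{−3}. Let R : ℂ → ℂ be holomorphic on the strip S_ρ̂ with |R(x)| ≤ M·e^{−ν|x|} for all x ∈ S_ρ̂. Then there exists a holomorphic function B : S_ρ̂ → ℂ such that B''(x) − 2iα·B'(x) − β²·B(x) = R(x) for all x ∈ S_ρ̂, and moreover |B(x)| ≤ 𝔊·M·ν^{−3}·(1 + |δ|)^{−1}·e^{−ν·Re(x)/2} and |B'(x)| ≤ 𝔊·M·e^{−ν·Re(x)/2} for all x ∈ S_ρ̂. -/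
open MeasureTheory Filter Topology Metric in
/-- Differentiation under the integral sign for a parametric family of holomorphic functions:
domination of the integrand suffices, since Cauchy's estimate dominates its derivative. -/
theorem hasDerivAt_integral_of_dominated_of_differentiableOn {μ : Measure ℝ} {F : ℂ → ℝ → ℂ}
    {x : ℂ} {ε : ℝ} (hε : 0 < ε) {b : ℝ → ℝ} (hb : Integrable b μ)
    (hm : ∀ z ∈ ball x ε, AEStronglyMeasurable (F z) μ)
    (hd : ∀ᵐ a ∂μ, DifferentiableOn ℂ (F · a) (ball x ε))
    (hle : ∀ᵐ a ∂μ, ∀ z ∈ ball x ε, ‖F z a‖ ≤ b a) :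
    Integrable (fun a ↦ deriv (F · a) x) μ ∧
      HasDerivAt (fun z ↦ ∫ a, F z a ∂μ) (∫ a, deriv (F · a) x ∂μ) x := by
  have hx : x ∈ ball x ε := mem_ball_self hε
  refine hasDerivAt_integral_of_dominated_loc_of_deriv_le (F := F)
    (F' := fun z a ↦ deriv (F · a) z) (s := ball x (ε / 2)) (bound := fun a ↦ b a / (ε / 4))
    (ball_mem_nhds x (half_pos hε)) ?_ ?_ ?_ ?_ (hb.div_const _) ?_
  · filter_upwards [ball_mem_nhds x hε] with z hz using hm z hz
  · exact hb.mono' (hm x hx) (hle.mono fun a ha ↦ ha x hx)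
  · let h : ℕ → ℂ := fun n ↦ ((ε / 2 / (n + 1) : ℝ) : ℂ)
    have hpos (n : ℕ) : 0 < ε / 2 / (n + 1 : ℝ) := by positivity
    have h0 (n : ℕ) : h n ≠ 0 := Complex.ofReal_ne_zero.2 (hpos n).ne'
    have hlim : Tendsto h atTop (𝓝[≠] 0) := by
      refine tendsto_nhdsWithin_iff.2 ⟨?_, .of_forall h0⟩
      have := tendsto_one_div_add_atTop_nhds_zero_nat (𝕜 := ℝ) |>.const_mul (ε / 2)
      rw [mul_zero] at this
      refine (Complex.continuous_ofReal.tendsto' 0 0 Complex.ofReal_zero).comp (this.congr ?_)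
      intro n
      ring
    have hmem (n : ℕ) : x + h n ∈ ball x ε := by
      have : ε / 2 / (n + 1 : ℝ) ≤ ε / 2 := div_le_self (by positivity) (by simp)
      simp only [mem_ball, dist_self_add_left, h, Complex.norm_real, Real.norm_eq_abs,
        abs_of_pos (hpos n)]
      linarith
    refine aestronglyMeasurable_of_tendsto_ae atTop
      (f := fun n a ↦ (h n)⁻¹ • (F (x + h n) a - F x a)) (fun n ↦ ?_) ?_
    · exact ((hm _ (hmem n)).sub (hm x hx)).const_smul (h n)⁻¹
    · filter_upwards [hd] with a ha
      exact (hasDerivAt_iff_tendsto_slope_zero.1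
        (ha.differentiableAt (isOpen_ball.mem_nhds hx)).hasDerivAt).comp hlim
  · filter_upwards [hd, hle] with a ha hla z hz
    have hsub : closedBall z (ε / 4) ⊆ ball x ε := by
      intro w hw
      have := dist_triangle w z x
      rw [mem_closedBall] at hw
      rw [mem_ball] at hz ⊢
      linarith
    exact Complex.norm_deriv_le_of_forall_mem_sphere_norm_le (by positivity)
      (ha.diffContOnCl_ball hsub) fun w hw ↦ hla w (hsub (sphere_subset_closedBall hw))
  · filter_upwards [hd] with a ha z hz
    exact (ha.differentiableAt
      (isOpen_ball.mem_nhds (ball_subset_ball (half_le_self hε.le) hz))).hasDerivAt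

open MeasureTheory Filter Topology Metric Set in
/-- The solution `y(x) = -∫₀^∞ e^{-rs} f(x + s) ds` of `y' = r y + f`. -/
theorem exists_hasDerivAt_of_exp_decay {S : Set ℂ} (hS : IsOpen S)
    (hadd : ∀ x ∈ S, ∀ s : ℝ, 0 ≤ s → x + s ∈ S) {f : ℂ → ℂ} (hf : DifferentiableOn ℂ f S)
    {ν C : ℝ} {r : ℂ} (hν : 0 ≤ ν) (hC : 0 ≤ C) (hr : 0 < ν + r.re)
    (hfC : ∀ x ∈ S, ‖f x‖ ≤ C * Real.exp (-ν * x.re)) :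
    ∃ y : ℂ → ℂ, ∀ x ∈ S, HasDerivAt y (r * y x + f x) x ∧
      ‖y x‖ ≤ C / (ν + r.re) * Real.exp (-ν * x.re) := by
  have hneg : -(ν + r.re) < 0 := neg_lt_zero.2 hr
  have hnorm (x : ℂ) (hx : x ∈ S) (s : ℝ) (hs : 0 ≤ s) : ‖Complex.exp (-r * s) * f (x + s)‖ ≤
      C * Real.exp (-ν * x.re) * Real.exp (-(ν + r.re) * s) := by
    rw [norm_mul, Complex.norm_exp]
    calc _ ≤ Real.exp ((-r * s).re) * (C * Real.exp (-ν * (x + s).re)) := by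
          gcongr; exact hfC _ (hadd x hx s hs)
      _ = _ := by
          rw [mul_left_comm, mul_assoc, ← Real.exp_add, ← Real.exp_add]
          congr 2
          simp
          ring
  have hint : IntegrableOn (fun s : ℝ ↦ Real.exp (-(ν + r.re) * s)) (Ioi 0) :=
    integrableOn_exp_mul_Ioi hneg 0
  have hshift (x : ℂ) (hx : x ∈ S) (s : ℝ) (hs : 0 ≤ s) :
      HasDerivAt (fun z ↦ f (z + s)) (deriv f (x + s)) x :=
    ((hf.differentiableAt (hS.mem_nhds (hadd x hx s hs))).hasDerivAt.comp_add_const x s)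
  have hcont (x : ℂ) (hx : x ∈ S) :
      ContinuousOn (fun s : ℝ ↦ Complex.exp (-r * s) * f (x + s)) (Ioi 0) :=
    .mul (by fun_prop) (hf.continuousOn.comp (by fun_prop) fun s hs ↦ hadd x hx s (le_of_lt hs))
  have hmeas (x : ℂ) (hx : x ∈ S) : AEStronglyMeasurable
      (fun s : ℝ ↦ Complex.exp (-r * s) * f (x + s)) (volume.restrict (Ioi 0)) :=
    (hcont x hx).aestronglyMeasurable measurableSet_Ioi
  refine ⟨fun x ↦ -∫ s : ℝ in Ioi 0, Complex.exp (-r * s) * f (x + s), fun x hx ↦ ⟨?_, ?_⟩⟩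
  · obtain ⟨ε, hε, hball⟩ := Metric.isOpen_iff.1 hS x hx
    obtain ⟨hi, hderiv⟩ := hasDerivAt_integral_of_dominated_of_differentiableOn
      (μ := volume.restrict (Ioi 0)) (F := fun z s ↦ Complex.exp (-r * s) * f (z + s)) (x := x) hε
      (b := fun s ↦ C * Real.exp (ν * (ε - x.re)) * Real.exp (-(ν + r.re) * s))
      (hint.const_mul _) (fun z hz ↦ hmeas z (hball hz))
      (by
        filter_upwards [ae_restrict_mem measurableSet_Ioi] with s hs z hz
        exact ((hshift z (hball hz) s (le_of_lt hs)).differentiableAt.const_mul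
          _).differentiableWithinAt)
      (by
        filter_upwards [ae_restrict_mem measurableSet_Ioi] with s hs z hz
        refine (hnorm z (hball hz) s (le_of_lt hs)).trans ?_
        have h1 : x.re - z.re ≤ ε := by
          have h2 := Complex.abs_re_le_norm (x - z)
          rw [mem_ball', Complex.dist_eq] at hz
          exact (le_abs_self _).trans (h2.trans hz.le)
        have : -ν * z.re ≤ ν * (ε - x.re) := by nlinarith
        gcongr)
    have hF : IntegrableOn (fun s : ℝ ↦ Complex.exp (-r * s) * f (x + s)) (Ioi 0) :=
      Integrable.mono' (hint.const_mul _) (hmeas x hx)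
        (by
          filter_upwards [ae_restrict_mem measurableSet_Ioi] with s hs
            using hnorm x hx s (le_of_lt hs))
    have hder (s : ℝ) (hs : s ∈ Ici (0 : ℝ)) :
        HasDerivAt (fun s : ℝ ↦ Complex.exp (-r * s) * f (x + s))
        (deriv (fun z ↦ Complex.exp (-r * s) * f (z + s)) x
          - r * (Complex.exp (-r * s) * f (x + s))) s := by
      rw [((hshift x hx s hs).const_mul _).deriv]
      have h1 : HasDerivAt (fun s : ℝ ↦ Complex.exp (-r * s)) (Complex.exp (-r * s) * (-r * 1)) s :=
        (((hasDerivAt_id (s : ℂ)).const_mul (-r)).cexp).comp_ofReal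
      have h2 : HasDerivAt (fun s : ℝ ↦ f (x + s)) (deriv f (x + s)) s :=
        ((hf.differentiableAt (hS.mem_nhds (hadd x hx s hs))).hasDerivAt.comp_const_add x
          (s : ℂ)).comp_ofReal
      refine (h1.mul h2).congr_deriv ?_
      ring
    have hlim : Tendsto (fun s : ℝ ↦ Complex.exp (-r * s) * f (x + s)) atTop (𝓝 0) := by
      refine squeeze_zero_norm' (a := fun s ↦ C * Real.exp (-ν * x.re) *
        Real.exp (-(ν + r.re) * s)) ?_ ?_
      · filter_upwards [eventually_ge_atTop 0] with s hs using hnorm x hx s hs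
      · rw [← mul_zero (C * Real.exp (-ν * x.re))]
        exact (Real.tendsto_exp_atBot.comp
          (tendsto_id.const_mul_atTop_of_neg hneg)).const_mul _
    have hFTC := integral_Ioi_of_hasDerivAt_of_tendsto' hder (hi.sub (hF.const_mul r)) hlim
    rw [integral_sub hi (hF.const_mul r), integral_const_mul] at hFTC
    refine hderiv.neg.congr_deriv ?_
    simp only [Complex.ofReal_zero, mul_zero, Complex.exp_zero, add_zero, one_mul] at hFTC
    linear_combination -hFTC
  · rw [norm_neg]
    refine (norm_integral_le_of_norm_le (hint.const_mul (C * Real.exp (-ν * x.re))) ?_).trans_eq ?_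
    · filter_upwards [ae_restrict_mem measurableSet_Ioi] with s hs
        using hnorm x hx s (le_of_lt hs)
    · rw [integral_const_mul, integral_exp_mul_Ioi hneg, mul_zero, Real.exp_zero, neg_div_neg_eq]
      ring

open MeasureTheory Filter Topology Metric Set in
/-- The solution `y(w) = e^{rw} ∫₀^w e^{-rt} g(t) dt` of `y' = r y + g`, on an open set which is
star-shaped about `0` but need not contain `0`. -/
theorem hasDerivAt_integral_smul_of_bounded {S : Set ℂ} (hS : IsOpen S)
    (hstar : ∀ w ∈ S, ∀ t : ℝ, t ∈ Ioc (0 : ℝ) 1 → t * w ∈ S) {g : ℂ → ℂ}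
    (hg : DifferentiableOn ℂ g S) {C : ℝ} (hgC : ∀ w ∈ S, ‖g w‖ ≤ C) (r : ℂ) {w : ℂ} (hw : w ∈ S) :
    HasDerivAt (fun w ↦ ∫ t : ℝ in Ioc 0 1, w * (Complex.exp (r * (1 - t) * w) * g (t * w)))
      (r * (∫ t : ℝ in Ioc 0 1, w * (Complex.exp (r * (1 - t) * w) * g (t * w))) + g w) w := by
  have hC : 0 ≤ C := (norm_nonneg _).trans (hgC w hw)
  have hexp (z : ℂ) (t : ℝ) (ht : t ∈ Icc (0 : ℝ) 1) :
      ‖Complex.exp (r * (1 - t) * z)‖ ≤ Real.exp (‖r‖ * ‖z‖) := by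
    rw [Complex.norm_exp]
    refine Real.exp_le_exp.2 ((Complex.re_le_norm _).trans ?_)
    have : ‖(1 - t : ℂ)‖ ≤ 1 := by
      rw [← Complex.ofReal_one, ← Complex.ofReal_sub, Complex.norm_real, Real.norm_eq_abs,
        abs_of_nonneg (by linarith [ht.2])]
      linarith [ht.1]
    rw [norm_mul, norm_mul]
    gcongr
    exact mul_le_of_le_one_right (norm_nonneg _) this
  have hcont (z : ℂ) (hz : z ∈ S) :
      ContinuousOn (fun t : ℝ ↦ Complex.exp (r * (1 - t) * z) * g (t * z)) (Ioc 0 1) :=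
    .mul (by fun_prop) (hg.continuousOn.comp (by fun_prop) fun t ht ↦ hstar z hz t ht)
  have hmeas (z : ℂ) (hz : z ∈ S) : AEStronglyMeasurable
      (fun t : ℝ ↦ z * (Complex.exp (r * (1 - t) * z) * g (t * z))) (volume.restrict (Ioc 0 1)) :=
    ((hcont z hz).const_smul z).aestronglyMeasurable measurableSet_Ioc
  have hgd (z : ℂ) (hz : z ∈ S) (t : ℝ) (ht : t ∈ Ioc (0 : ℝ) 1) :
      HasDerivAt g (deriv g (t * z)) (t * z) :=
    (hg.differentiableAt (hS.mem_nhds (hstar z hz t ht))).hasDerivAt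
  have hd (z : ℂ) (hz : z ∈ S) (t : ℝ) (ht : t ∈ Ioc (0 : ℝ) 1) :
      HasDerivAt (fun z ↦ z * (Complex.exp (r * (1 - t) * z) * g (t * z)))
        (1 * (Complex.exp (r * (1 - t) * z) * g (t * z)) +
          z * (Complex.exp (r * (1 - t) * z) * (r * (1 - t) * 1) * g (t * z) +
            Complex.exp (r * (1 - t) * z) * (deriv g (t * z) * (t * 1)))) z :=
    (hasDerivAt_id z).mul ((((hasDerivAt_id z).const_mul _).cexp).mul
      ((hgd z hz t ht).comp z ((hasDerivAt_id z).const_mul (t : ℂ))))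
  have hnorm (z : ℂ) (hz : z ∈ S) (t : ℝ) (ht : t ∈ Ioc (0 : ℝ) 1) :
      ‖Complex.exp (r * (1 - t) * z) * g (t * z)‖ ≤ Real.exp (‖r‖ * ‖z‖) * C := by
    rw [norm_mul]
    gcongr
    · exact hexp z t (Ioc_subset_Icc_self ht)
    · exact hgC _ (hstar z hz t ht)
  obtain ⟨ε, hε, hball⟩ := Metric.isOpen_iff.1 hS w hw
  obtain ⟨hi, hderiv⟩ := hasDerivAt_integral_of_dominated_of_differentiableOn
    (μ := volume.restrict (Ioc 0 1))
    (F := fun z t ↦ z * (Complex.exp (r * (1 - t) * z) * g (t * z))) (x := w) hε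
    (b := fun _ ↦ (‖w‖ + ε) * (Real.exp (‖r‖ * (‖w‖ + ε)) * C))
    (integrable_const _) (fun z hz ↦ hmeas z (hball hz))
    (by
      filter_upwards [ae_restrict_mem measurableSet_Ioc] with t ht z hz
      exact (hd z (hball hz) t ht).differentiableAt.differentiableWithinAt)
    (by
      filter_upwards [ae_restrict_mem measurableSet_Ioc] with t ht z hz
      have h1 : ‖z‖ ≤ ‖w‖ + ε := by
        rw [mem_ball, Complex.dist_eq] at hz
        linarith [norm_sub_norm_le z w]
      rw [norm_mul]
      grw [hnorm z (hball hz) t ht, h1]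
      gcongr)
  have hF : IntegrableOn (fun t : ℝ ↦ w * (Complex.exp (r * (1 - t) * w) * g (t * w)))
      (Ioc 0 1) := by
    refine Integrable.mono' (integrable_const (‖w‖ * (Real.exp (‖r‖ * ‖w‖) * C))) (hmeas w hw) ?_
    filter_upwards [ae_restrict_mem measurableSet_Ioc] with t ht
    rw [norm_mul]
    grw [hnorm w hw t ht]
  let H : ℝ → ℂ := fun t ↦ t * (Complex.exp (r * (1 - t) * w) * g (t * w))
  have hHc : ContinuousOn H (Icc 0 1) := by
    intro t ht
    rcases ht.1.eq_or_lt with rfl | h0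
    · have h : H 0 = 0 := by simp [H]
      rw [ContinuousWithinAt, h]
      refine squeeze_zero_norm' (a := fun t : ℝ ↦ t * (Real.exp (‖r‖ * ‖w‖) * C)) ?_ ?_
      · filter_upwards [self_mem_nhdsWithin] with t ht
        rcases ht.1.eq_or_lt with rfl | h0
        · simp [H]
        · rw [norm_mul, Complex.norm_real, Real.norm_of_nonneg ht.1]
          grw [hnorm w hw t ⟨h0, ht.2⟩]
      · exact ((continuous_id.mul continuous_const).tendsto' 0 0 (by simp)).mono_left
          nhdsWithin_le_nhds
    · have h1 : ContinuousWithinAt H (Ioc 0 1) t :=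
        (Complex.continuous_ofReal.continuousOn.mul (hcont w hw)) t ⟨h0, ht.2⟩
      refine h1.mono_of_mem_nhdsWithin ?_
      filter_upwards [self_mem_nhdsWithin, nhdsWithin_le_nhds (Ioi_mem_nhds h0)] with s hs hs'
        using ⟨hs', hs.2⟩
  have hHd (t : ℝ) (ht : t ∈ Ioo (0 : ℝ) 1) : HasDerivAt H
      (deriv (fun z ↦ z * (Complex.exp (r * (1 - t) * z) * g (t * z))) w
        - r * (w * (Complex.exp (r * (1 - t) * w) * g (t * w)))) t := by
    have ht' := Ioo_subset_Ioc_self ht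
    rw [(hd w hw t ht').deriv]
    have h1 := (hasDerivAt_id (t : ℂ)).mul
      ((((((hasDerivAt_id (t : ℂ)).const_sub 1).const_mul r).mul_const w).cexp).mul
      ((hgd w hw t ht').comp (t : ℂ) ((hasDerivAt_id (t : ℂ)).mul_const w)))
    refine h1.comp_ofReal.congr_deriv ?_
    simp only [Function.comp_apply, id_eq, Pi.mul_apply]
    ring
  have hFTC := intervalIntegral.integral_eq_sub_of_hasDerivAt_of_le zero_le_one hHc hHd
    ((intervalIntegrable_iff_integrableOn_Ioc_of_le zero_le_one).2 (hi.sub (hF.const_mul r)))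
  rw [intervalIntegral.integral_of_le zero_le_one, integral_sub hi (hF.const_mul r),
    integral_const_mul] at hFTC
  refine hderiv.congr_deriv ?_
  have h1 : H 1 = g w := by simp [H]
  have h0 : H 0 = 0 := by simp [H]
  rw [h1, h0] at hFTC
  linear_combination hFTC

open MeasureTheory Set in
/-- A solution of `y' = (iα - d) y + f` on a semi-infinite strip whose decay rate is limited by the
decay of the homogeneous solution, obtained by integrating from the left end of the strip. -/
theorem exists_hasDerivAt_of_half_le {ν ρ α d C : ℝ} (hν : 0 < ν) (hρ : ρ ∈ Ioc (0 : ℝ) 1)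
    (hα : 0 ≤ α) (hd : ν / 2 ≤ d) (hC : 0 ≤ C) {S : Set ℂ} (hSo : IsOpen S)
    (hS : S = {x : ℂ | -ρ < x.re ∧ |x.im| < ρ}) {f : ℂ → ℂ} (hf : DifferentiableOn ℂ f S)
    (hfC : ∀ x ∈ S, ‖f x‖ ≤ C * Real.exp (-ν * x.re)) :
    ∃ y : ℂ → ℂ, ∀ x ∈ S, HasDerivAt y ((Complex.I * α - d) * y x + f x) x ∧
      ‖y x‖ ≤ C * Real.exp (α + ν / 2) * (1 + 2 / ν) * Real.exp (-ν * x.re / 2) := by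
  set r : ℂ := Complex.I * α - d with hr
  let T : Set ℂ := {w | w - ρ ∈ S}
  have hT (w : ℂ) : w ∈ T ↔ 0 < w.re ∧ |w.im| < ρ := by simp [T, hS]
  have hTo : IsOpen T := hSo.preimage (continuous_id.sub continuous_const)
  have hstar : ∀ w ∈ T, ∀ t : ℝ, t ∈ Ioc (0 : ℝ) 1 → t * w ∈ T := by
    intro w hw t ht
    rw [hT] at hw ⊢
    rw [Complex.re_ofReal_mul, Complex.im_ofReal_mul, abs_mul, abs_of_pos ht.1]
    exact ⟨mul_pos ht.1 hw.1, (mul_le_of_le_one_left (abs_nonneg _) ht.2).trans_lt hw.2⟩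
  have hg : DifferentiableOn ℂ (fun w ↦ f (w - ρ)) T :=
    hf.comp (by fun_prop) fun w hw ↦ hw
  have hgC (w : ℂ) (hw : w ∈ T) : ‖f (w - ρ)‖ ≤ C * Real.exp (-ν * (w.re - ρ)) := by
    simpa using hfC _ hw
  have hgC' (w : ℂ) (hw : w ∈ T) : ‖f (w - ρ)‖ ≤ C * Real.exp (ν * ρ) := by
    refine (hgC w hw).trans ?_
    have : -ν * (w.re - ρ) ≤ ν * ρ := by nlinarith [((hT w).1 hw).1]
    gcongr
  have hmem (x : ℂ) (hx : x ∈ S) : x + ρ ∈ T := by simpa [T] using hx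
  refine ⟨fun x ↦ ∫ t : ℝ in Ioc 0 1,
    (x + ρ) * (Complex.exp (r * (1 - t) * (x + ρ)) * f (t * (x + ρ) - ρ)), fun x hx ↦ ⟨?_, ?_⟩⟩
  · have h := hasDerivAt_integral_smul_of_bounded hTo hstar hg hgC' r (hmem x hx)
    simpa using h.comp_add_const x (ρ : ℂ)
  · set w := x + ρ with hw
    obtain ⟨hre, him⟩ := (hT w).1 (hmem x hx)
    have hxre : x.re = w.re - ρ := by simp [hw]
    set L := w.re with hL
    have hwn : ‖w‖ ≤ L + 1 := by
      have := Complex.norm_le_abs_re_add_abs_im w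
      rw [abs_of_pos hre] at this
      linarith [hρ.2]
    have hc : 0 < ν / 2 * L := by positivity
    have hcont : Continuous fun t : ℝ ↦ Real.exp (-(ν / 2 * L) * t) := by fun_prop
    have hint : ∫ t : ℝ in Ioc 0 1, (L + 1) * Real.exp (-(ν / 2 * L) * t) ≤ 1 + 2 / ν := by
      have h1 : ∫ t : ℝ in Ioc 0 1, Real.exp (-(ν / 2 * L) * t) ≤ 1 := by
        rw [← intervalIntegral.integral_of_le zero_le_one]
        calc _ ≤ ∫ t : ℝ in (0 : ℝ)..1, (1 : ℝ) :=
              intervalIntegral.integral_mono_on zero_le_one (hcont.intervalIntegrable _ _)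
                (by simp) fun t ht ↦ Real.exp_le_one_iff.2 (by nlinarith [ht.1])
          _ = 1 := by simp
      have h2 : ∫ t : ℝ in Ioc 0 1, Real.exp (-(ν / 2 * L) * t) ≤ 1 / (ν / 2 * L) := by
        refine (setIntegral_mono_set (integrableOn_exp_mul_Ioi (neg_lt_zero.2 hc) 0)
          (.of_forall fun t ↦ (Real.exp_pos _).le) Ioc_subset_Ioi_self.eventuallyLE).trans_eq ?_
        rw [integral_exp_mul_Ioi (neg_lt_zero.2 hc), mul_zero, Real.exp_zero, neg_div_neg_eq]
      rw [integral_const_mul]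
      calc _ = L * (∫ t : ℝ in Ioc 0 1, Real.exp (-(ν / 2 * L) * t)) +
            ∫ t : ℝ in Ioc 0 1, Real.exp (-(ν / 2 * L) * t) := by ring
        _ ≤ L * (1 / (ν / 2 * L)) + 1 := by gcongr
        _ = _ := by field_simp; ring
    calc _ ≤ ∫ t : ℝ in Ioc 0 1, C * Real.exp (α + ν / 2) * Real.exp (-ν * x.re / 2) *
            ((L + 1) * Real.exp (-(ν / 2 * L) * t)) := by
          refine norm_integral_le_of_norm_le
            ((hcont.integrableOn_Icc.mono_set Ioc_subset_Icc_self).const_mul _ |>.const_mul _) ?_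
          filter_upwards [ae_restrict_mem measurableSet_Ioc] with t ht
          have h1 := hgC _ (hstar w (hmem x hx) t ht)
          rw [Complex.re_ofReal_mul, ← hL] at h1
          have h2 : (r * (1 - t) * w).re = (1 - t) * (-(α * w.im) - d * L) := by
            simp [hr, ← hL]
            ring
          rw [norm_mul, norm_mul, Complex.norm_exp, h2]
          grw [hwn, h1]
          have h3 : (1 - t) * (-(α * w.im) - d * L) + -ν * (t * L - ρ) ≤
              α + ν / 2 + -ν * x.re / 2 + -(ν / 2 * L) * t := by
            have h4 : -(α * w.im) ≤ α := by
              have := (abs_lt.1 him).1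
              nlinarith [hρ.2]
            have h5 : (1 - t) * (-(α * w.im)) ≤ α := by
              nlinarith [ht.1, ht.2]
            have h6 : ν / 2 * L * (1 - t) ≤ d * L * (1 - t) := by
              have := ht.2
              gcongr
            have h7 : ν * ρ ≤ ν := mul_le_of_le_one_right hν.le hρ.2
            rw [hxre]
            linarith
          calc _ = C * (L + 1) * Real.exp ((1 - t) * (-(α * w.im) - d * L) + -ν * (t * L - ρ)) := by
                rw [Real.exp_add]; ring
            _ ≤ C * (L + 1) * Real.exp (α + ν / 2 + -ν * x.re / 2 + -(ν / 2 * L) * t) := by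
                gcongr
            _ = _ := by rw [Real.exp_add, Real.exp_add]; ring
      _ ≤ C * Real.exp (α + ν / 2) * Real.exp (-ν * x.re / 2) * (1 + 2 / ν) := by
          rw [integral_const_mul]
          gcongr
      _ = _ := by ring

/-- If `B₁` and `B₂` are the first and second derivatives of `B` on an open set, then `B` solves
there any linear second-order equation satisfied by `B`, `B₁` and `B₂`. -/
theorem deriv_deriv_eq_of_hasDerivAt {S : Set ℂ} (hS : IsOpen S) {B B₁ B₂ : ℂ → ℂ}
    (h₁ : ∀ x ∈ S, HasDerivAt B (B₁ x) x) (h₂ : ∀ x ∈ S, HasDerivAt B₁ (B₂ x) x) {x : ℂ}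
    (hx : x ∈ S) : deriv (deriv B) x = B₂ x := by
  have h : deriv B =ᶠ[nhds x] B₁ := by
    filter_upwards [hS.mem_nhds hx] with z hz using (h₁ z hz).deriv
  rw [h.deriv_eq, (h₂ x hx).deriv]


/-- Uniform solvability estimate for the family of ODEs `B'' − 2iα·B' − β²·B = R` on the
semi-infinite strip `S_ρ̂ = {x : Re x > −ρ̂, |Im x| < ρ̂}`: with
`δ = √(β² − α²)` (or `i√(α² − β²)` when `β < α`), `δ₋ ≤ |δ|` whenever `δ ≠ 0`,
`|δ| ≤ δ₊` whenever `β < α` and `𝔊 = 64(2+α) e^{α+2ν+δ₊} δ₋⁻¹ ν⁻³`, there is a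
holomorphic solution `B` with `|B(x)| ≤ 𝔊 M ν⁻³ (1+|δ|)⁻¹ e^{−ν Re(x)/2}` and
`|B'(x)| ≤ 𝔊 M e^{−ν Re(x)/2}`. -/
theorem ode_uniform_solvability
    (ν ρ : ℝ) (hν : ν ∈ Set.Ioc (0:ℝ) 1) (hρ : ρ ∈ Set.Ioc (0:ℝ) 1)
    (α β M : ℝ) (hα : 0 < α) (hβ : 0 < β) (hM : 0 ≤ M)
    (δ : ℂ)
    (hδ : δ = if α ≤ β then ((Real.sqrt (β ^ 2 - α ^ 2) : ℝ) : ℂ)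
              else Complex.I * (Real.sqrt (α ^ 2 - β ^ 2) : ℝ))
    (δm δp : ℝ) (hδm : δm ∈ Set.Ioc (0:ℝ) 1)
    (hδmle : δ ≠ 0 → δm ≤ ‖δ‖)
    (hδp : 0 ≤ δp) (hδple : β < α → ‖δ‖ ≤ δp)
    (G : ℝ) (hG : G = 64 * (2 + α) * Real.exp (α + 2 * ν + δp) * δm⁻¹ * ν⁻¹ ^ 3)
    (S : Set ℂ) (hS : S = {x : ℂ | -ρ < x.re ∧ |x.im| < ρ})
    (R : ℂ → ℂ) (hR : DifferentiableOn ℂ R S)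
    (hRbound : ∀ x ∈ S, ‖R x‖ ≤ M * Real.exp (-ν * ‖x‖)) :
    ∃ B : ℂ → ℂ, DifferentiableOn ℂ B S ∧
      (∀ x ∈ S,
        deriv (deriv B) x - 2 * Complex.I * α * deriv B x - (β : ℂ) ^ 2 * B x = R x) ∧
      (∀ x ∈ S, ‖B x‖ ≤
        G * M * ν⁻¹ ^ 3 * (1 + ‖δ‖)⁻¹ * Real.exp (-ν * x.re / 2)) ∧
      (∀ x ∈ S, ‖deriv B x‖ ≤ G * M * Real.exp (-ν * x.re / 2)) := by
  obtain ⟨hν0, hν1⟩ := hν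
  obtain ⟨hδm0, hδm1⟩ := hδm
  have hSo : IsOpen S := by
    rw [hS]
    exact (isOpen_lt continuous_const Complex.continuous_re).inter
      (isOpen_lt Complex.continuous_im.abs continuous_const)
  have hadd : ∀ x ∈ S, ∀ s : ℝ, 0 ≤ s → x + s ∈ S := by
    intro x hx s hs
    rw [hS] at hx ⊢
    exact ⟨by simpa using hx.1.trans_le (le_add_of_nonneg_right hs), by simpa using hx.2⟩
  have hRe (x : ℂ) (hx : x ∈ S) : ‖R x‖ ≤ M * Real.exp (-ν * x.re) := by
    refine (hRbound x hx).trans ?_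
    have : -ν * ‖x‖ ≤ -ν * x.re := by nlinarith [Complex.re_le_norm x]
    gcongr
  have hdecay (x : ℂ) (hx : x ∈ S) :
      Real.exp (-ν * x.re) ≤ Real.exp (ν / 2) * Real.exp (-ν * x.re / 2) := by
    rw [← Real.exp_add]
    have : -1 ≤ x.re := by
      rw [hS] at hx
      linarith [hx.1, hρ.2]
    exact Real.exp_le_exp.2 (by nlinarith)
  have hνinv : 1 ≤ ν⁻¹ := (one_le_inv₀ hν0).2 hν1
  have hδinv : 1 ≤ δm⁻¹ := (one_le_inv₀ hδm0).2 hδm1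
  have hδsq : δ ^ 2 = (β : ℂ) ^ 2 - (α : ℂ) ^ 2 := by
    rw [hδ]
    split_ifs with h
    · rw [← Complex.ofReal_pow, Real.sq_sqrt (by nlinarith)]
      push_cast
      rfl
    · rw [mul_pow, ← Complex.ofReal_pow, Real.sq_sqrt (by nlinarith), Complex.I_sq]
      push_cast
      ring
  set A : ℝ := Real.exp (α + ν / 2) with hA
  have hexpA : Real.exp (ν / 2) ≤ A := Real.exp_le_exp.2 (by linarith)
  have hAG : A ≤ Real.exp (α + 2 * ν + δp) := Real.exp_le_exp.2 (by linarith)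
  have hA0 : 0 < A := Real.exp_pos _
  have hG0 : 64 * (2 + α) * A * δm⁻¹ * ν⁻¹ ^ 3 ≤ G := by rw [hG]; gcongr
  by_cases hδ0 : δ = 0
  · obtain ⟨y, hy⟩ := exists_hasDerivAt_of_exp_decay (r := Complex.I * α) hSo hadd hR hν0.le hM
      (by simpa using hν0) hRe
    have hre : (Complex.I * α).re = 0 := by simp
    simp only [hre, add_zero] at hy
    obtain ⟨B, hB⟩ := exists_hasDerivAt_of_exp_decay (r := Complex.I * α) hSo hadd
      (fun x hx ↦ (hy x hx).1.differentiableAt.differentiableWithinAt) hν0.le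
      (div_nonneg hM hν0.le) (by simpa using hν0) fun x hx ↦ (hy x hx).2
    simp only [hre, add_zero] at hB
    have hd2 (x : ℂ) (hx : x ∈ S) :
        HasDerivAt (fun z ↦ Complex.I * α * B z + y z)
          (Complex.I * α * (Complex.I * α * B x + y x) + (Complex.I * α * y x + R x)) x :=
      ((hB x hx).1.const_mul _).add (hy x hx).1
    have hyb (x : ℂ) (hx : x ∈ S) : ‖y x‖ ≤ ν⁻¹ * M * A * Real.exp (-ν * x.re / 2) := by
      grw [(hy x hx).2, hdecay x hx, hexpA]
      exact le_of_eq (by ring)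
    have hBb (x : ℂ) (hx : x ∈ S) : ‖B x‖ ≤ ν⁻¹ ^ 2 * M * A * Real.exp (-ν * x.re / 2) := by
      grw [(hB x hx).2, hdecay x hx, hexpA]
      exact le_of_eq (by ring)
    have hν3 : ν⁻¹ ^ 2 ≤ ν⁻¹ ^ 3 := pow_le_pow_right₀ hνinv (by norm_num)
    have hν31 : ν⁻¹ ≤ ν⁻¹ ^ 3 := by
      simpa using pow_le_pow_right₀ hνinv (show 1 ≤ 3 by norm_num)
    have hGA : (2 + α) * A * ν⁻¹ ^ 3 ≤ G := by
      refine le_trans ?_ hG0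
      have : 1 ≤ 64 * δm⁻¹ := by linarith
      calc _ = (2 + α) * A * ν⁻¹ ^ 3 * 1 := by ring
        _ ≤ (2 + α) * A * ν⁻¹ ^ 3 * (64 * δm⁻¹) := by gcongr
        _ = _ := by ring
    refine ⟨B, fun x hx ↦ (hB x hx).1.differentiableAt.differentiableWithinAt, fun x hx ↦ ?_,
      fun x hx ↦ ?_, fun x hx ↦ ?_⟩
    · rw [deriv_deriv_eq_of_hasDerivAt hSo (fun z hz ↦ (hB z hz).1) hd2 hx, (hB x hx).1.deriv]
      rw [hδ0] at hδsq
      linear_combination B x * hδsq - α ^ 2 * B x * Complex.I_sq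
    · refine (hBb x hx).trans ?_
      rw [hδ0, norm_zero, add_zero, inv_one, mul_one]
      have hG1 : A ≤ G := by
        refine le_trans ?_ hGA
        calc A = 1 * A * 1 := by ring
          _ ≤ (2 + α) * A * ν⁻¹ ^ 3 := by
            gcongr
            · linarith
            · exact one_le_pow₀ hνinv
      calc _ ≤ ν⁻¹ ^ 3 * M * G * Real.exp (-ν * x.re / 2) := by gcongr
        _ = _ := by ring
    · rw [(hB x hx).1.deriv]
      grw [norm_add_le, norm_mul, hyb x hx, hBb x hx]
      have hn : ‖Complex.I * α‖ = α := by simp [abs_of_pos hα]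
      rw [hn]
      calc _ = (α * ν⁻¹ ^ 2 + ν⁻¹) * A * (M * Real.exp (-ν * x.re / 2)) := by ring
        _ ≤ ((2 + α) * A * ν⁻¹ ^ 3) * (M * Real.exp (-ν * x.re / 2)) := by
          have : α * ν⁻¹ ^ 2 + ν⁻¹ ≤ (2 + α) * ν⁻¹ ^ 3 := by nlinarith
          rw [mul_right_comm (2 + α)]
          gcongr
        _ ≤ _ := by rw [mul_assoc G]; gcongr
  · have hsolve (r : ℂ) (hr : -(ν / 2) ≤ r.re) : ∃ y : ℂ → ℂ, ∀ x ∈ S,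
        HasDerivAt y (r * y x + R x) x ∧ ‖y x‖ ≤ 3 * ν⁻¹ * A * M * Real.exp (-ν * x.re / 2) := by
      obtain ⟨y, hy⟩ := exists_hasDerivAt_of_exp_decay (r := r) hSo hadd hR hν0.le hM
        (by linarith) hRe
      refine ⟨y, fun x hx ↦ ⟨(hy x hx).1, ?_⟩⟩
      have h1 : M / (ν + r.re) ≤ 3 * ν⁻¹ * M := by
        rw [div_le_iff₀ (by linarith)]
        have : 1 ≤ 3 * ν⁻¹ * (ν + r.re) := by
          have : ν / 2 ≤ ν + r.re := by linarith
          calc (1 : ℝ) ≤ 3 * ν⁻¹ * (ν / 2) := by field_simp; norm_num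
            _ ≤ _ := by gcongr
        nlinarith
      grw [(hy x hx).2, h1, hdecay x hx, hexpA]
      exact le_of_eq (by ring)
    obtain ⟨yp, hyp⟩ := hsolve (Complex.I * α + δ) (by
      rw [hδ]
      split_ifs
      · have := Real.sqrt_nonneg (β ^ 2 - α ^ 2)
        simp only [Complex.add_re, Complex.re_mul_ofReal, Complex.I_re, Complex.ofReal_re]
        linarith
      · simp only [Complex.add_re, Complex.re_mul_ofReal, Complex.I_re]
        linarith)
    obtain ⟨ym, hym⟩ : ∃ y : ℂ → ℂ, ∀ x ∈ S, HasDerivAt y ((Complex.I * α - δ) * y x + R x) x ∧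
        ‖y x‖ ≤ 3 * ν⁻¹ * A * M * Real.exp (-ν * x.re / 2) := by
      by_cases hre : δ.re ≤ ν / 2
      · exact hsolve _ (by simpa using hre)
      · have hδr : δ = (δ.re : ℂ) := by
          rw [hδ] at hre ⊢
          split_ifs at hre ⊢
          · simp
          · simp at hre
            linarith
        obtain ⟨y, hy⟩ := exists_hasDerivAt_of_half_le hν0 hρ hα.le (not_le.1 hre).le hM hSo hS
          hR hRe
        rw [← hδr] at hy
        refine ⟨y, fun x hx ↦ ⟨(hy x hx).1, (hy x hx).2.trans ?_⟩⟩
        have : 1 + 2 / ν ≤ 3 * ν⁻¹ := by rw [div_eq_mul_inv]; linarith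
        grw [this]
        exact le_of_eq (by ring)
    set K : ℝ := 3 * ν⁻¹ * A * M with hK
    have hK0 : 0 ≤ K := by positivity
    have hδn : 0 < ‖δ‖ := norm_pos_iff.2 hδ0
    have hδi : ‖δ‖⁻¹ ≤ δm⁻¹ := inv_anti₀ hδm0 (hδmle hδ0)
    have hd1 (x : ℂ) (hx : x ∈ S) : HasDerivAt (fun z ↦ (2 * δ)⁻¹ * (yp z - ym z))
        ((2 * δ)⁻¹ * ((Complex.I * α + δ) * yp x - (Complex.I * α - δ) * ym x)) x :=
      (((hyp x hx).1.sub (hym x hx).1).const_mul _).congr_deriv (by ring)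
    have hd2 (x : ℂ) (hx : x ∈ S) :
        HasDerivAt (fun z ↦ (2 * δ)⁻¹ * ((Complex.I * α + δ) * yp z - (Complex.I * α - δ) * ym z))
        ((2 * δ)⁻¹ * ((Complex.I * α + δ) * ((Complex.I * α + δ) * yp x + R x) -
          (Complex.I * α - δ) * ((Complex.I * α - δ) * ym x + R x))) x :=
      (((hyp x hx).1.const_mul _).sub ((hym x hx).1.const_mul _)).const_mul _
    have hn2 : ‖(2 * δ)⁻¹‖ = ‖δ‖⁻¹ / 2 := by
      rw [norm_inv, norm_mul, Complex.norm_two, mul_inv]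
      ring
    refine ⟨_, fun x hx ↦ (hd1 x hx).differentiableAt.differentiableWithinAt, fun x hx ↦ ?_,
      fun x hx ↦ ?_, fun x hx ↦ ?_⟩
    · rw [deriv_deriv_eq_of_hasDerivAt hSo hd1 hd2 hx, (hd1 x hx).deriv]
      have hβ2 : (β : ℂ) ^ 2 = δ ^ 2 + α ^ 2 := by rw [hδsq]; ring
      rw [hβ2]
      field_simp
      linear_combination -α ^ 2 * (yp x - ym x) * Complex.I_sq
    · rw [norm_mul, hn2]
      grw [norm_sub_le, (hyp x hx).2, (hym x hx).2]
      have h1 : ‖δ‖⁻¹ ≤ 2 * δm⁻¹ * (1 + ‖δ‖)⁻¹ := by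
        rw [← div_eq_mul_inv, le_div_iff₀ (by positivity), mul_add, mul_one,
          inv_mul_cancel₀ hδn.ne']
        linarith
      have h2 : 6 * ν⁻¹ * A * δm⁻¹ ≤ G * ν⁻¹ ^ 3 := by
        have hν3 : 1 ≤ ν⁻¹ ^ 3 := one_le_pow₀ hνinv
        have hν4 : ν⁻¹ ≤ ν⁻¹ ^ 3 := by
          simpa using pow_le_pow_right₀ hνinv (show 1 ≤ 3 by norm_num)
        calc _ ≤ 64 * (2 + α) * ν⁻¹ ^ 3 * A * δm⁻¹ * 1 := by
              rw [mul_one]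
              gcongr
              linarith
          _ = (64 * (2 + α) * A * δm⁻¹ * ν⁻¹ ^ 3) * 1 := by ring
          _ ≤ _ := by
              have : 0 ≤ G := le_trans (by positivity) hG0
              gcongr
      calc _ = ‖δ‖⁻¹ * (K * Real.exp (-ν * x.re / 2)) := by ring
        _ ≤ 2 * δm⁻¹ * (1 + ‖δ‖)⁻¹ * (K * Real.exp (-ν * x.re / 2)) := by gcongr
        _ = (6 * ν⁻¹ * A * δm⁻¹) * (M * (1 + ‖δ‖)⁻¹ * Real.exp (-ν * x.re / 2)) := by
          rw [hK]; ring
        _ ≤ (G * ν⁻¹ ^ 3) * (M * (1 + ‖δ‖)⁻¹ * Real.exp (-ν * x.re / 2)) := by gcongr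
        _ = _ := by ring
    · have hn : ‖Complex.I * α‖ = α := by simp [abs_of_pos hα]
      have hp : ‖Complex.I * α + δ‖ ≤ α + ‖δ‖ := (norm_add_le _ _).trans_eq (by rw [hn])
      have hm : ‖Complex.I * α - δ‖ ≤ α + ‖δ‖ := (norm_sub_le _ _).trans_eq (by rw [hn])
      rw [(hd1 x hx).deriv, norm_mul, hn2]
      grw [norm_sub_le, norm_mul, norm_mul, hp, hm, (hyp x hx).2, (hym x hx).2]
      have h1 : ‖δ‖⁻¹ * (α + ‖δ‖) ≤ (2 + α) * δm⁻¹ := by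
        rw [mul_add, inv_mul_cancel₀ hδn.ne']
        nlinarith
      have h2 : 3 * ν⁻¹ * (2 + α) * A * δm⁻¹ ≤ G := by
        have hν4 : ν⁻¹ ≤ ν⁻¹ ^ 3 := by
          simpa using pow_le_pow_right₀ hνinv (show 1 ≤ 3 by norm_num)
        calc _ ≤ 64 * ν⁻¹ ^ 3 * (2 + α) * A * δm⁻¹ := by
              gcongr
              norm_num
          _ = 64 * (2 + α) * A * δm⁻¹ * ν⁻¹ ^ 3 := by ring
          _ ≤ _ := hG0
      calc _ = ‖δ‖⁻¹ * (α + ‖δ‖) * (K * Real.exp (-ν * x.re / 2)) := by ring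
        _ ≤ (2 + α) * δm⁻¹ * (K * Real.exp (-ν * x.re / 2)) := by gcongr
        _ = 3 * ν⁻¹ * (2 + α) * A * δm⁻¹ * (M * Real.exp (-ν * x.re / 2)) := by
          rw [hK]; ring
        _ ≤ G * (M * Real.exp (-ν * x.re / 2)) := by gcongr
        _ = _ := by ring
end

section
/- Let δ ∈ (0, 1/2], ρ̂ > 0, set ρ := ρ̂ + δ, and let K, L ≥ 0. Let (a_l)_{l∈ℤ}, (a'_l)_{l∈ℤ}, (b_l)_{l∈ℤ}, (b'_l)_{l∈ℤ} be complex numbers satisfying: |l|·|a_l| ≤ K·e^{−|l|ρ̂} for all l ≠ 0, |a'_l| ≤ δ^{−1}·K·e^{−|l|ρ̂} for all l ∈ ℤ, |b_l| ≤ L·e^{−|l|ρ} for all l ∈ ℤ, and |b'_l| ≤ δ^{−1}·L·e^{−|l|ρ} for all l ∈ ℤ. Then for every m ∈ ℤ the series Σ_{l∈ℤ} l·(a_l·b'_{m−l} − b_l·a'_{m−l}) converges absolutely and |Σ_{l∈ℤ} l·(a_l·b'_{m−l} − b_l·a'_{m−l})| ≤ 8·K·L·δ^{−3}·e^{−|m|ρ̂}.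 -/
/-- The two-sided geometric series `∑ q ^ |k|` over the integers. -/
theorem hasSum_int_pow_natAbs {q : ℝ} (hq₀ : 0 ≤ q) (hq₁ : q < 1) :
    HasSum (fun k : ℤ => q ^ k.natAbs) (2 * (1 - q)⁻¹ - 1) := by
  have h := hasSum_geometric_of_lt_one hq₀ hq₁
  have hsum := HasSum.of_nat_of_neg (f := fun k : ℤ => q ^ k.natAbs)
    (g := (1 - q)⁻¹) (g' := (1 - q)⁻¹) (by simpa using h) (by simpa using h)
  simpa [two_mul] using hsum

/-- The two-sided series `∑ |k| q ^ |k|` over the integers. -/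
theorem hasSum_int_natAbs_mul_pow_natAbs {q : ℝ} (hq₀ : 0 ≤ q) (hq₁ : q < 1) :
    HasSum (fun k : ℤ => (k.natAbs : ℝ) * q ^ k.natAbs) (2 * (q / (1 - q) ^ 2)) := by
  have h := hasSum_coe_mul_geometric_of_norm_lt_one (𝕜 := ℝ) (r := q)
    (by rwa [Real.norm_of_nonneg hq₀])
  have hsum := HasSum.of_nat_of_neg (f := fun k : ℤ => (k.natAbs : ℝ) * q ^ k.natAbs)
    (g := q / (1 - q) ^ 2) (g' := q / (1 - q) ^ 2)
    (by simpa only [Int.natAbs_natCast] using h)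
    (by simpa only [Int.natAbs_neg, Int.natAbs_natCast] using h)
  simpa [two_mul] using hsum

/-- Bound on the sums of the two-sided series with ratio `e ^ (-δ)`. -/
theorem two_sided_exp_sums_le {δ : ℝ} (hδ₀ : 0 < δ) (hδ₁ : δ ≤ 1 / 2) :
    (2 * (1 - Real.exp (-δ))⁻¹ - 1) + 2 * (Real.exp (-δ) / (1 - Real.exp (-δ)) ^ 2) ≤
      8 * δ⁻¹ ^ 2 := by
  have hq₁ : Real.exp (-δ) < 1 := Real.exp_zero ▸ Real.exp_lt_exp.2 (by linarith)
  have hq : Real.exp (-δ) * (1 + δ) ≤ 1 := by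
    calc Real.exp (-δ) * (1 + δ) ≤ Real.exp (-δ) * Real.exp δ := by
          gcongr
          linarith [Real.add_one_le_exp δ]
      _ = 1 := by rw [← Real.exp_add]; simp
  set q := Real.exp (-δ)
  have hinv : (1 - q)⁻¹ ≤ (3 / 2) * δ⁻¹ := by
    rw [inv_le_iff_one_le_mul₀ (by linarith), ← div_eq_mul_inv, div_mul_eq_mul_div,
      le_div_iff₀ hδ₀]
    nlinarith
  have hinv₀ : 0 ≤ (1 - q)⁻¹ := inv_nonneg.2 (by linarith)
  have hδinv : 2 ≤ δ⁻¹ := by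
    rw [le_inv_comm₀ two_pos hδ₀]
    linarith
  have hsq : q / (1 - q) ^ 2 ≤ ((3 / 2) * δ⁻¹) ^ 2 := by
    calc q / (1 - q) ^ 2 ≤ 1 / (1 - q) ^ 2 := by gcongr
      _ = (1 - q)⁻¹ ^ 2 := by rw [one_div, inv_pow]
      _ ≤ _ := by gcongr
  nlinarith

/-- Triangle inequality `|m| ≤ |k| + |m - k|` in exponential form: the excess decay `δ` on the
index `k` survives in the product. -/
theorem exp_mul_exp_le_exp_mul_pow {δ ρ x y z : ℝ} (hρ : 0 ≤ ρ) (k : ℤ) (hy : y = |(k : ℝ)|)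
    (hxyz : z ≤ x + y) :
    Real.exp (-x * ρ) * Real.exp (-y * (ρ + δ)) ≤
      Real.exp (-z * ρ) * Real.exp (-δ) ^ k.natAbs := by
  rw [← Real.exp_add, ← Real.exp_nat_mul, ← Real.exp_add, Nat.cast_natAbs, Int.cast_abs, ← hy]
  refine Real.exp_le_exp.2 ?_
  nlinarith [mul_le_mul_of_nonneg_right hxyz hρ]

/-- Bracket estimate: if `|l|·|a_l| ≤ K e^{−|l|ρ̂}` (`l ≠ 0`), `|a'_l| ≤ δ⁻¹K e^{−|l|ρ̂}`,
`|b_l| ≤ L e^{−|l|ρ}`, `|b'_l| ≤ δ⁻¹L e^{−|l|ρ}` with `ρ = ρ̂ + δ`, `δ ∈ (0,1/2]`, then for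
every `m` the bracket series `Σ_l l·(a_l·b'_{m−l} − b_l·a'_{m−l})` converges absolutely and
is bounded by `8KLδ⁻³ e^{−|m|ρ̂}`. -/
theorem bracket_estimate
    (δ ρh : ℝ) (hδ : δ ∈ Set.Ioc (0:ℝ) (1/2)) (hρh : 0 < ρh)
    (ρ : ℝ) (hρ : ρ = ρh + δ)
    (K L : ℝ) (hK : 0 ≤ K) (hL : 0 ≤ L)
    (a a' b b' : ℤ → ℂ)
    (ha : ∀ l : ℤ, l ≠ 0 → |(l:ℝ)| * ‖a l‖ ≤ K * Real.exp (-|(l:ℝ)| * ρh))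
    (ha' : ∀ l : ℤ, ‖a' l‖ ≤ δ⁻¹ * K * Real.exp (-|(l:ℝ)| * ρh))
    (hb : ∀ l : ℤ, ‖b l‖ ≤ L * Real.exp (-|(l:ℝ)| * ρ))
    (hb' : ∀ l : ℤ, ‖b' l‖ ≤ δ⁻¹ * L * Real.exp (-|(l:ℝ)| * ρ)) :
    ∀ m : ℤ,
      Summable (fun l : ℤ => (l : ℂ) * (a l * b' (m - l) - b l * a' (m - l))) ∧
      ‖∑' l : ℤ, (l : ℂ) * (a l * b' (m - l) - b l * a' (m - l))‖ ≤
        8 * K * L * δ⁻¹ ^ 3 * Real.exp (-|(m:ℝ)| * ρh) := by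
  subst hρ
  intro m
  obtain ⟨hδ₀, hδ₁⟩ := hδ
  have ha_all : ∀ l : ℤ, |(l:ℝ)| * ‖a l‖ ≤ K * Real.exp (-|(l:ℝ)| * ρh) := by
    intro l
    rcases eq_or_ne l 0 with rfl | hl
    · simpa using hK
    · exact ha l hl
  set q := Real.exp (-δ)
  have hq₀ : 0 ≤ q := (Real.exp_pos _).le
  have hq₁ : q < 1 := Real.exp_zero ▸ Real.exp_lt_exp.2 (by linarith)
  set C := K * L * δ⁻¹ * Real.exp (-|(m:ℝ)| * ρh) with hC
  have hC₀ : 0 ≤ C := by positivity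
  have htri : ∀ l : ℤ, |(m:ℝ)| ≤ |(l:ℝ)| + |((m - l : ℤ) : ℝ)| := fun l => by
    simpa using abs_add_le (l : ℝ) ((m - l : ℤ) : ℝ)
  have hbound : ∀ l : ℤ, ‖(l : ℂ) * (a l * b' (m - l) - b l * a' (m - l))‖ ≤
      C * (q ^ (m - l).natAbs + (l.natAbs : ℝ) * q ^ l.natAbs) := by
    intro l
    have h₁ : |(l:ℝ)| * ‖a l‖ * ‖b' (m - l)‖ ≤ C * q ^ (m - l).natAbs := by
      calc |(l:ℝ)| * ‖a l‖ * ‖b' (m - l)‖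
          ≤ (K * Real.exp (-|(l:ℝ)| * ρh)) *
            (δ⁻¹ * L * Real.exp (-|((m - l : ℤ):ℝ)| * (ρh + δ))) :=
            mul_le_mul (ha_all l) (hb' _) (norm_nonneg _) (by positivity)
        _ = K * L * δ⁻¹ * (Real.exp (-|(l:ℝ)| * ρh) *
            Real.exp (-|((m - l : ℤ):ℝ)| * (ρh + δ))) := by ring
        _ ≤ K * L * δ⁻¹ * (Real.exp (-|(m:ℝ)| * ρh) * q ^ (m - l).natAbs) := by
            exact mul_le_mul_of_nonneg_left
              (exp_mul_exp_le_exp_mul_pow hρh.le (m - l) rfl (htri l)) (by positivity)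
        _ = C * q ^ (m - l).natAbs := by rw [hC]; ring
    have h₂ : ‖b l‖ * ‖a' (m - l)‖ ≤ C * q ^ l.natAbs := by
      calc ‖b l‖ * ‖a' (m - l)‖
          ≤ (L * Real.exp (-|(l:ℝ)| * (ρh + δ))) *
            (δ⁻¹ * K * Real.exp (-|((m - l : ℤ):ℝ)| * ρh)) :=
            mul_le_mul (hb l) (ha' _) (norm_nonneg _) (by positivity)
        _ = K * L * δ⁻¹ * (Real.exp (-|((m - l : ℤ):ℝ)| * ρh) *
            Real.exp (-|(l:ℝ)| * (ρh + δ))) := by ring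
        _ ≤ K * L * δ⁻¹ * (Real.exp (-|(m:ℝ)| * ρh) * q ^ l.natAbs) := by
            exact mul_le_mul_of_nonneg_left
              (exp_mul_exp_le_exp_mul_pow hρh.le l rfl ((htri l).trans_eq (add_comm _ _))) (by positivity)
        _ = C * q ^ l.natAbs := by rw [hC]; ring
    have hl : (l.natAbs : ℝ) = |(l:ℝ)| := by rw [Nat.cast_natAbs, Int.cast_abs]
    calc ‖(l : ℂ) * (a l * b' (m - l) - b l * a' (m - l))‖
        ≤ |(l:ℝ)| * (‖a l‖ * ‖b' (m - l)‖ + ‖b l‖ * ‖a' (m - l)‖) := by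
          rw [norm_mul, Complex.norm_intCast, ← norm_mul (a l), ← norm_mul (b l)]
          gcongr
          exact norm_sub_le _ _
      _ = |(l:ℝ)| * ‖a l‖ * ‖b' (m - l)‖ + |(l:ℝ)| * (‖b l‖ * ‖a' (m - l)‖) := by ring
      _ ≤ C * q ^ (m - l).natAbs + |(l:ℝ)| * (C * q ^ l.natAbs) := by gcongr
      _ = _ := by rw [hl]; ring
  have hsum := (((Equiv.subLeft m).hasSum_iff.2 (hasSum_int_pow_natAbs hq₀ hq₁)).add
    (hasSum_int_natAbs_mul_pow_natAbs hq₀ hq₁)).mul_left C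
  refine ⟨Summable.of_norm_bounded hsum.summable hbound,
    (tsum_of_norm_bounded hsum hbound).trans ?_⟩
  calc _ ≤ C * (8 * δ⁻¹ ^ 2) := by
        gcongr
        exact two_sided_exp_sums_le hδ₀ hδ₁
    _ = _ := by rw [hC]; ring
end
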